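/- arXiv:1301.4313 — 6 statements merged into one kernel-verified Lean document; each statement's English description precedes it below -/
import Mathlib

section
/- Let k be a field of characteristic zero, let f ∈ k[x] be squarefree and nonzero, let ℓ ≥ 1 be an integer, and let a ∈ k[x]. Then there exist polynomials r, s, V ∈ k[x] with deg r < deg f such that a = (r + s·f)·f^{ℓ−1} + f·V′ − (ℓ−1)·V·f′. (This polynomial identity encodes the Hermite additive decomposition a/f^ℓ = r/f + s + d/dx(V/f^{ℓ−1}) in k(x).) -/
open Polynomial

/-- Hermite reduction: modulo the numerators `f·V′ − n·V·f′` of exact derivatives of `V / f ^ n`,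
every polynomial is a multiple of `f ^ n`. -/
theorem exists_eq_mul_pow_add_hermite {k : Type*} [Field k] [CharZero k]
    (f : k[X]) (hf : IsCoprime f (derivative f)) (n : ℕ) (a : k[X]) :
    ∃ c V : k[X], a = c * f ^ n + f * derivative V - (n : k[X]) * V * derivative f := by
  induction n generalizing a with
  | zero => exact ⟨a, 0, by simp⟩
  | succ n ih =>
    obtain ⟨u, w, huw⟩ := hf
    have hinv : ((n + 1 : ℕ) : k[X]) * C ((n + 1 : ℕ) : k)⁻¹ = 1 := by
      rw [← C_eq_natCast, ← C_mul, mul_inv_cancel₀ (Nat.cast_ne_zero.mpr n.succ_ne_zero), C_1]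
    set W : k[X] := -(C ((n + 1 : ℕ) : k)⁻¹ * (a * w)) with hW
    obtain ⟨c, V, hV⟩ := ih (a * u - derivative W)
    have hnW : ((n + 1 : ℕ) : k[X]) * W = -(a * w) := by
      rw [hW]
      linear_combination (-(a * w)) * hinv
    refine ⟨c, W + f * V, ?_⟩
    rw [derivative_add, derivative_mul]
    push_cast at hnW ⊢
    linear_combination f * hV - a * huw + derivative f * hnW

/-- Hermite additive decomposition: for `f` squarefree nonzero, `ℓ ≥ 1` and any `a`,
there are `r, s, V` with `deg r < deg f` and
`a = (r + s·f)·f^{ℓ−1} + f·V′ − (ℓ−1)·V·f′`, encoding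
`a/f^ℓ = r/f + s + d/dx(V/f^{ℓ−1})`. -/
theorem hermite_additive_decomposition {k : Type*} [Field k] [CharZero k]
    (f : k[X]) (hf : IsCoprime f (derivative f)) (hf0 : f ≠ 0)
    (ℓ : ℕ) (hℓ : 1 ≤ ℓ) (a : k[X]) :
    ∃ r s V : k[X], r.degree < f.degree ∧
      a = (r + s * f) * f ^ (ℓ - 1) + f * derivative V
            - ((ℓ - 1 : ℕ) : k[X]) * V * derivative f := by
  obtain ⟨c, V, hV⟩ := exists_eq_mul_pow_add_hermite f hf (ℓ - 1) a
  refine ⟨c % f, c / f, V, EuclideanDomain.mod_lt c hf0, ?_⟩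
  rwa [mul_comm (c / f) f, EuclideanDomain.mod_add_div]
end

section
/- Let k be a field of characteristic zero, let f ∈ k[x] be squarefree and nonzero, and let r ∈ k[x] with deg r < deg f. If there exist polynomials p, q ∈ k[x] with q ≠ 0 such that r·q² = (p′·q − p·q′)·f, then r = 0. (This is the normalization property of Hermite reduction: a nonzero proper fraction r/f with squarefree denominator is never the derivative of a rational function.) -/
open Polynomial

/-- If `π` is an irreducible factor of `q` that does not divide `p`, and `f` is squarefree, then
the pole of `(p / q)'` at `π` has order at least two, so `f * (p / q)'` still has a pole there. -/
theorem not_sq_dvd_wronskian_mul {k : Type*} [Field k] [CharZero k] {p q f π : k[X]}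
    (hf : Squarefree f) (hq : q ≠ 0) (hπ : Irreducible π) (hπq : π ∣ q) (hπp : ¬ π ∣ p) :
    ¬ q ^ 2 ∣ (derivative p * q - p * derivative q) * f := by
  intro h
  obtain ⟨n, u, hu, rfl⟩ := WfDvdMonoid.max_power_factor hq hπ
  have hprime : Prime π := hπ.prime
  obtain _ | m := n
  · exact hu (by simpa using hπq)
  have hW : derivative p * (π ^ (m + 1) * u) - p * derivative (π ^ (m + 1) * u) =
      π ^ m * (π * (derivative p * u - p * derivative u) -
        C ((m : k) + 1) * (p * (derivative π * u))) := by
    simp [derivative_mul, derivative_pow_succ]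
    ring
  have hπ' : ¬ π ∣ derivative π := fun hd =>
    hπ.not_isUnit (hπ.separable.isUnit_of_dvd' dvd_rfl hd)
  have hndvd : ¬ π ∣ π * (derivative p * u - p * derivative u) -
      C ((m : k) + 1) * (p * (derivative π * u)) := by
    rw [dvd_sub_right (dvd_mul_right _ _)]
    have hC : IsUnit (C ((m : k) + 1)) :=
      isUnit_C.mpr (isUnit_iff_ne_zero.mpr (Nat.cast_add_one_ne_zero m))
    rw [hC.dvd_mul_left, hprime.dvd_mul, hprime.dvd_mul]
    tauto
  have hpow : π ^ m * π ^ 2 ∣ (π ^ (m + 1) * u) ^ 2 :=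
    ⟨π ^ m * u ^ 2, by ring⟩
  have hdvd := hpow.trans h
  rw [hW, mul_assoc, mul_dvd_mul_iff_left (pow_ne_zero m hπ.ne_zero)] at hdvd
  have hsq : π ^ 2 ∣ f := hprime.pow_dvd_of_dvd_mul_left 2 hndvd hdvd
  exact hπ.not_isUnit (hf π (by rwa [← sq]))

/-- Normalization property of Hermite reduction: a proper fraction `r/f` with
squarefree denominator which is the derivative of a rational function `p/q`
(encoded by `r·q² = (p′·q − p·q′)·f`) must vanish. -/
theorem hermite_normalization {k : Type*} [Field k] [CharZero k]
    (f : k[X]) (hf : IsCoprime f (derivative f)) (hf0 : f ≠ 0)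
    (r : k[X]) (hr : r.degree < f.degree)
    (h : ∃ p q : k[X], q ≠ 0 ∧ r * q ^ 2 = (derivative p * q - p * derivative q) * f) :
    r = 0 := by
  obtain ⟨p, q, hq, h⟩ := h
  obtain ⟨a, b, c, hab, rfl, rfl⟩ := UniqueFactorizationMonoid.exists_reduced_factors' p q hq
  have hc : c ≠ 0 := left_ne_zero_of_mul hq
  have hb : b ≠ 0 := right_ne_zero_of_mul hq
  have hred : r * b ^ 2 = (derivative a * b - a * derivative b) * f := by
    apply mul_left_cancel₀ (pow_ne_zero 2 hc)
    simp only [derivative_mul] at h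
    linear_combination h
  have hbu : IsUnit b := by
    by_contra hbu
    obtain ⟨π, hπ, hπb⟩ := WfDvdMonoid.exists_irreducible_factor hbu hb
    exact not_sq_dvd_wronskian_mul (Separable.squarefree hf) hb hπ hπb
      (fun hπa => hπ.not_isUnit (hab hπa hπb)) (hred ▸ dvd_mul_left _ _)
  have hdvd : f ∣ r := (hbu.pow 2).dvd_mul_right.mp (hred ▸ dvd_mul_left _ _)
  exact eq_zero_of_dvd_of_degree_lt hdvd hr
end

section
/- (Macaulay's bound) Let L be a field of characteristic zero, let n ≥ 1, and let f ∈ L[x_0,…,x_n] be a homogeneous polynomial of degree d ≥ 2 satisfying Hypothesis (H). Then every homogeneous polynomial of degree at least (n+1)(d−2)+1 lies in the Jacobian ideal Jac f. -/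
open MvPolynomial

namespace Macaulay

section Bezoutian

variable {σ R : Type*} [Fintype σ] [DecidableEq σ] [CommRing R]

/-- Divided differences of a monomial: the outer variables of
`MvPolynomial σ (MvPolynomial σ R)` play the role of `x`, the inner ones that of `y`. -/
lemma exists_dividedDifference_monomial (n : ℕ) (s : σ →₀ ℕ) (hs : s.degree ≤ n) (a : R) :
    ∃ b : σ → MvPolynomial σ (MvPolynomial σ R),
      (∀ j, (b j).totalDegree ≤ n - 1) ∧
      map C (monomial s a) - C (monomial s a) = ∑ j, b j * (X j - C (X j)) := by
  induction n generalizing s with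
  | zero =>
    obtain rfl : s = 0 := (Finsupp.degree_eq_zero_iff s).mp (Nat.le_zero.mp hs)
    exact ⟨0, by simp, by simp⟩
  | succ n ih =>
    by_cases h0 : s = 0
    · subst h0
      exact ⟨0, by simp, by simp⟩
    · obtain ⟨k, hk⟩ := Finsupp.ne_iff.mp h0
      obtain ⟨t, rfl⟩ : ∃ t, s = t + Finsupp.single k 1 :=
        ⟨s - Finsupp.single k 1, (tsub_add_cancel_of_le (by
          rw [Finsupp.single_le_iff]
          exact Nat.one_le_iff_ne_zero.mpr hk)).symm⟩
      have ht : t.degree ≤ n := by simpa using hs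
      obtain ⟨b, hb, hbe⟩ := ih t ht
      refine ⟨fun j => C (X k) * b j + if j = k then map C (monomial t a) else 0, fun j => ?_, ?_⟩
      · refine (totalDegree_add _ _).trans (max_le ?_ ?_)
        · refine (totalDegree_mul _ _).trans ?_
          have := hb j
          simp only [totalDegree_C]
          omega
        · split_ifs
          · rw [map_monomial]
            exact (totalDegree_monomial_le _ _).trans ht
          · simp
      · have e : ∑ j, (C (X k) * b j + if j = k then map C (monomial t a) else 0)
            * (X j - C (X j))
            = C (X k) * ∑ j, b j * (X j - C (X j)) + map C (monomial t a) * (X k - C (X k)) := by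
          simp [add_mul, Finset.sum_add_distrib, Finset.mul_sum, mul_assoc]
        rw [e, ← hbe, monomial_add_single]
        simp only [pow_one, map_mul, map_X]
        ring

lemma exists_dividedDifference (p : MvPolynomial σ R) (n : ℕ) (hp : p.totalDegree ≤ n) :
    ∃ b : σ → MvPolynomial σ (MvPolynomial σ R),
      (∀ j, (b j).totalDegree ≤ n - 1) ∧
      map C p - C p = ∑ j, b j * (X j - C (X j)) := by
  have h : ∀ s : p.support, ∃ b : σ → MvPolynomial σ (MvPolynomial σ R),
      (∀ j, (b j).totalDegree ≤ n - 1) ∧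
      map C (monomial s.1 (coeff s.1 p)) - C (monomial s.1 (coeff s.1 p))
        = ∑ j, b j * (X j - C (X j)) := fun s =>
    exists_dividedDifference_monomial n s.1 ((le_totalDegree s.2).trans hp) _
  choose b hb hbe using h
  refine ⟨fun j => ∑ s, b s j, fun j => totalDegree_finsetSum_le fun s _ => hb s j, ?_⟩
  simp_rw [Finset.sum_mul]
  rw [Finset.sum_comm]
  simp_rw [← hbe]
  rw [Finset.sum_sub_distrib, ← map_sum, ← map_sum,
    Finset.sum_coe_sort p.support (fun s => monomial s (coeff s p)), ← as_sum]

/-- Cramer's rule for the product of a determinant with a vector. -/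
lemma det_mul_eq_sum_adjugate {S : Type*} [CommRing S] (A : Matrix σ σ S) (v : σ → S) (j : σ) :
    A.det * v j = ∑ i, A.adjugate j i * (A.mulVec v) i := by
  have h : A.adjugate.mulVec (A.mulVec v) = A.det • v := by
    rw [Matrix.mulVec_mulVec, Matrix.adjugate_mul, Matrix.smul_mulVec, Matrix.one_mulVec]
  exact (congrFun h j).symm

lemma totalDegree_det_le {S : Type*} [CommRing S] (A : Matrix σ σ (MvPolynomial σ S)) (n : ℕ)
    (hA : ∀ i j, (A i j).totalDegree ≤ n) : A.det.totalDegree ≤ Fintype.card σ * n := by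
  rw [Matrix.det_apply]
  refine totalDegree_finsetSum_le fun τ _ => ?_
  have h : (∏ i, A (τ i) i).totalDegree ≤ Fintype.card σ * n := by
    refine (totalDegree_finsetProd _ _).trans ?_
    refine (Finset.sum_le_card_nsmul _ _ n fun i _ => hA _ _).trans ?_
    simp
  rcases Int.units_eq_one_or (Equiv.Perm.sign τ) with hτ | hτ <;> simpa [hτ] using h

end Bezoutian

section Functional

variable {σ R : Type*} [CommRing R]

/-- The extension of an `R`-linear functional in the variables `x` to a functional on polynomials
in `x` with coefficients polynomials in `y`. -/
noncomputable def extendFunctional (φ : MvPolynomial σ R →ₗ[R] R) :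
    MvPolynomial σ (MvPolynomial σ R) →ₗ[MvPolynomial σ R] MvPolynomial σ R :=
  (basisMonomials σ (MvPolynomial σ R)).constr (MvPolynomial σ R)
    fun s => C (φ (monomial s 1))

variable (φ : MvPolynomial σ R →ₗ[R] R)

lemma extendFunctional_monomial (s : σ →₀ ℕ) (c : MvPolynomial σ R) :
    extendFunctional φ (monomial s c) = c * C (φ (monomial s 1)) := by
  have h : monomial s c = c • basisMonomials σ (MvPolynomial σ R) s := by
    simp [smul_monomial]
  rw [h, map_smul, extendFunctional, Module.Basis.constr_basis, smul_eq_mul]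

lemma extendFunctional_map_mul_monomial (p : MvPolynomial σ R) (s : σ →₀ ℕ)
    (c : MvPolynomial σ R) :
    extendFunctional φ (map C p * monomial s c) = c * C (φ (p * monomial s 1)) := by
  induction p using MvPolynomial.induction_on' with
  | monomial u a =>
    have h : monomial (u + s) a = a • monomial (u + s) (1 : R) := by simp [smul_monomial]
    rw [map_monomial, monomial_mul, extendFunctional_monomial, monomial_mul, mul_one, h, map_smul,
      smul_eq_mul, C_mul]
    ring
  | add p q hp hq => simp only [map_add, add_mul, hp, hq, mul_add]

lemma extendFunctional_map_mul_eq_zero (p : MvPolynomial σ R) (hp : ∀ q, φ (p * q) = 0)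
    (c : MvPolynomial σ (MvPolynomial σ R)) : extendFunctional φ (map C p * c) = 0 := by
  induction c using MvPolynomial.induction_on' with
  | monomial u a => simp [extendFunctional_map_mul_monomial, hp]
  | add c d hc hd => rw [mul_add, map_add, hc, hd, add_zero]

lemma extendFunctional_map_mul_eq_constantCoeff (p : MvPolynomial σ R)
    (hp : φ p = 1) (hp' : ∀ s, s ≠ 0 → φ (p * monomial s 1) = 0)
    (c : MvPolynomial σ (MvPolynomial σ R)) :
    extendFunctional φ (map C p * c) = constantCoeff c := by
  classical
  induction c using MvPolynomial.induction_on' with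
  | monomial u a =>
    rw [extendFunctional_map_mul_monomial, constantCoeff_monomial]
    split_ifs with h
    · subst h
      simp [hp]
    · simp [hp' u h]
  | add c d hc hd => rw [mul_add, map_add, map_add, hc, hd]

lemma extendFunctional_eq_zero_of_totalDegree_le (n : ℕ)
    (hφ : ∀ s : σ →₀ ℕ, s.degree ≤ n → φ (monomial s 1) = 0)
    (c : MvPolynomial σ (MvPolynomial σ R)) (hc : c.totalDegree ≤ n) :
    extendFunctional φ c = 0 := by
  rw [c.as_sum, map_sum]
  refine Finset.sum_eq_zero fun s hs => ?_
  rw [extendFunctional_monomial, hφ s ((le_totalDegree hs).trans hc), map_zero, mul_zero]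

end Functional

section PurePowers

variable {σ R : Type*} [CommRing R]

lemma mem_span_X_pow_iff (M : ℕ) (t : Set σ) (q : MvPolynomial σ R) :
    q ∈ Ideal.span ((fun i => (X i : MvPolynomial σ R) ^ M) '' t) ↔
      ∀ s ∈ q.support, ∃ i ∈ t, M ≤ s i := by
  have h : (fun i => (X i : MvPolynomial σ R) ^ M) '' t =
      (fun s => monomial s (1 : R)) '' ((fun i => Finsupp.single i M) '' t) := by
    simp only [Set.image_image, X_pow_eq_monomial]
  rw [h, mem_ideal_span_monomial_image]
  simp [Finsupp.single_le_iff]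

lemma mem_span_X_pow_of_mul_X_mem (M : ℕ) (i : σ) (q : MvPolynomial σ R)
    (h : q * X i ∈ Ideal.span ((fun i => (X i : MvPolynomial σ R) ^ M) '' {i}ᶜ)) :
    q ∈ Ideal.span ((fun i => (X i : MvPolynomial σ R) ^ M) '' {i}ᶜ) := by
  rw [mem_span_X_pow_iff] at h ⊢
  intro s hs
  obtain ⟨k, hk, hM⟩ := h (s + Finsupp.single i 1) (by
    rw [mem_support_iff, coeff_mul_X]
    exact mem_support_iff.mp hs)
  refine ⟨k, hk, ?_⟩
  have hki : i ≠ k := fun h => hk h.symm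
  simpa [Finsupp.single_apply, hki] using hM

variable [Fintype σ] [DecidableEq σ]

/-- Replacing rows of a matrix `c` with `c x = (x_i ^ M)` does not change its determinant modulo
the ideal of the `x_i ^ M`. -/
lemma det_sub_det_mem_span_X_pow (M : ℕ) (t : Finset σ) (c c' : Matrix σ σ (MvPolynomial σ R))
    (hc : ∀ i, (c.mulVec X) i = X i ^ M) (hc' : ∀ i, (c'.mulVec X) i = X i ^ M)
    (hcc : ∀ i ∉ t, c i = c' i) :
    c.det - c'.det ∈ Ideal.span (Set.range fun i => (X i : MvPolynomial σ R) ^ M) := by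
  induction t using Finset.induction_on generalizing c with
  | empty =>
    obtain rfl : c = c' := funext fun i => hcc i (by simp)
    simp
  | insert i t hi ih =>
    have h₁ := ih (c.updateRow i (c' i)) (fun k => by
        rcases eq_or_ne k i with rfl | hk
        · simpa [Matrix.mulVec] using hc' k
        · simpa [Matrix.mulVec, hk] using hc k) (fun k hk => by
        rcases eq_or_ne k i with rfl | hki
        · simp
        · simpa [hki] using hcc k (by simp [hk, hki]))
    have h₂ : c.det - (c.updateRow i (c' i)).det = (c.updateRow i (c i - c' i)).det := by
      have := Matrix.det_updateRow_add c i (c i - c' i) (c' i)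
      rw [sub_add_cancel, Matrix.updateRow_eq_self] at this
      rw [this, add_sub_cancel_right]
    have h₃ : (c.updateRow i (c i - c' i)).det ∈
        Ideal.span ((fun i => (X i : MvPolynomial σ R) ^ M) '' {i}ᶜ) := by
      refine mem_span_X_pow_of_mul_X_mem M i _ ?_
      rw [det_mul_eq_sum_adjugate]
      refine Ideal.sum_mem _ fun k _ => Ideal.mul_mem_left _ _ ?_
      rcases eq_or_ne k i with rfl | hk
      · have : ((c.updateRow k (c k - c' k)).mulVec X) k = 0 := by
          have e : ((c.updateRow k (c k - c' k)).mulVec X) k =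
              (c.mulVec X) k - (c'.mulVec X) k := by
            simp [Matrix.mulVec, dotProduct, sub_mul]
          rw [e, hc, hc', sub_self]
        rw [this]
        exact zero_mem _
      · have : ((c.updateRow i (c i - c' i)).mulVec X) k = X k ^ M := by
          simpa [Matrix.mulVec, hk] using hc k
        rw [this]
        exact Ideal.subset_span ⟨k, hk, rfl⟩
    have h₄ := Ideal.span_mono (Set.image_subset_range _ _) h₃
    rw [← h₂] at h₄
    simpa using add_mem h₄ h₁

lemma prod_X_pow_notMem_span_X_pow [Nontrivial R] (M : ℕ) :
    (∏ i, (X i : MvPolynomial σ R) ^ M) ∉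
      Ideal.span (Set.range fun i => (X i : MvPolynomial σ R) ^ (M + 1)) := by
  rw [← Set.image_univ, mem_span_X_pow_iff]
  intro h
  have e : (∏ i, (X i : MvPolynomial σ R) ^ M) =
      monomial (Finsupp.equivFunOnFinite.symm fun _ => M) 1 := by
    rw [monomial_eq, Finsupp.prod_fintype _ _ (by simp)]
    simp
  obtain ⟨i, -, hi⟩ := h (Finsupp.equivFunOnFinite.symm fun _ => M) (by
    rw [mem_support_iff, e, coeff_monomial, if_pos rfl]
    exact one_ne_zero)
  simp at hi

/-- If `f = a x` and the ideal of the `f i` contains a power of every variable, then `det a` is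
not in that ideal. -/
lemma det_notMem_span [Nontrivial R] (f : σ → MvPolynomial σ R)
    (a : Matrix σ σ (MvPolynomial σ R)) (ha : a.mulVec X = f) (M : ℕ)
    (hM : ∀ i, X i ^ (M + 1) ∈ Ideal.span (Set.range f)) :
    a.det ∉ Ideal.span (Set.range f) := by
  intro hdet
  choose b hb using fun i => Ideal.mem_span_range_iff_exists_fun.mp (hM i)
  have hbf : (Matrix.of b).mulVec f = fun i => X i ^ (M + 1) := funext hb
  have h₁ : (Matrix.of b * a).det ∈
      Ideal.span (Set.range fun i => (X i : MvPolynomial σ R) ^ (M + 1)) := by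
    obtain ⟨g, hg⟩ := Ideal.mem_span_range_iff_exists_fun.mp hdet
    rw [Matrix.det_mul, ← hg, Finset.mul_sum]
    refine Ideal.sum_mem _ fun j _ => ?_
    rw [mul_left_comm, det_mul_eq_sum_adjugate, hbf]
    exact Ideal.mul_mem_left _ _ (Ideal.sum_mem _ fun i _ =>
      Ideal.mul_mem_left _ _ (Ideal.subset_span ⟨i, rfl⟩))
  have h₂ := det_sub_det_mem_span_X_pow (M + 1) Finset.univ (Matrix.of b * a)
    (Matrix.diagonal fun i => (X i : MvPolynomial σ R) ^ M)
    (fun i => by rw [← Matrix.mulVec_mulVec, ha, hbf])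
    (fun i => by rw [Matrix.mulVec_diagonal, pow_succ]) (by simp)
  refine prod_X_pow_notMem_span_X_pow (σ := σ) (R := R) M ?_
  rw [← Matrix.det_diagonal]
  simpa using sub_mem h₁ h₂

end PurePowers

section Bound

variable {σ K : Type*} [Field K]

lemma homogeneousComponent_mem_span (f : σ → MvPolynomial σ K) (m : ℕ)
    (hf : ∀ i, (f i).IsHomogeneous m) {p : MvPolynomial σ K}
    (hp : p ∈ Ideal.span (Set.range f)) (k : ℕ) :
    homogeneousComponent k p ∈ Ideal.span (Set.range f) := by
  let _ := MvPolynomial.gradedAlgebra (σ := σ) (R := K)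
  refine homogeneousComponent_mem_of_mem (Ideal.homogeneous_span _ _ ?_) hp k
  rintro _ ⟨i, rfl⟩
  exact ⟨m, hf i⟩

lemma exists_X_pow_mem_span (f : σ → MvPolynomial σ K) (m : ℕ)
    (hf : ∀ i, (f i).IsHomogeneous m)
    (hfin : Module.Finite K (MvPolynomial σ K ⧸ Ideal.span (Set.range f))) (i : σ) :
    ∃ k, X i ^ k ∈ Ideal.span (Set.range f) := by
  set I := Ideal.span (Set.range f)
  obtain ⟨P, hP, hP0⟩ := Algebra.IsIntegral.isIntegral (R := K) (Ideal.Quotient.mk I (X i))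
  have h : Polynomial.aeval (X i : MvPolynomial σ K) P ∈ I := by
    rw [← Ideal.Quotient.eq_zero_iff_mem, ← Ideal.Quotient.mkₐ_eq_mk K I,
      ← Polynomial.aeval_algHom_apply]
    exact hP0
  refine ⟨P.natDegree, ?_⟩
  have hk := homogeneousComponent_mem_span f m hf h P.natDegree
  rw [Polynomial.aeval_eq_sum_range, map_sum, Finset.sum_eq_single P.natDegree] at hk
  · rwa [hP.coeff_natDegree, one_smul,
      homogeneousComponent_of_mem (isHomogeneous_X_pow i P.natDegree), if_pos rfl] at hk
  · intro j _ hj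
    rw [map_smul, homogeneousComponent_of_mem (isHomogeneous_X_pow i j), if_neg hj.symm, smul_zero]
  · simp

/-- Macaulay's bound for as many forms of the same positive degree as there are variables. -/
theorem mem_span_of_isHomogeneous [Fintype σ] (f : σ → MvPolynomial σ K) (m : ℕ) (hm : 1 ≤ m)
    (hf : ∀ i, (f i).IsHomogeneous m)
    (hfin : Module.Finite K (MvPolynomial σ K ⧸ Ideal.span (Set.range f)))
    (e : ℕ) (he : Fintype.card σ * (m - 1) < e) (g : MvPolynomial σ K) (hg : g.IsHomogeneous e) :
    g ∈ Ideal.span (Set.range f) := by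
  classical
  by_contra hgI
  -- A functional of degree `e` on the quotient that does not vanish at `g`.
  obtain ⟨ψ, hψg, hψI⟩ := Submodule.exists_le_ker_of_notMem
    (p := (Ideal.span (Set.range f)).restrictScalars K) hgI
  let φ : MvPolynomial σ K →ₗ[K] K := (ψ g)⁻¹ • ψ ∘ₗ homogeneousComponent e
  have hφI : ∀ p ∈ Ideal.span (Set.range f), φ p = 0 := fun p hp => by
    have : ψ (homogeneousComponent e p) = 0 := hψI (homogeneousComponent_mem_span f m hf hp e)
    simp [φ, this]
  have hφg : φ g = 1 := by
    simp [φ, homogeneousComponent_eq_self hg, hψg]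
  have hφhom : ∀ (k : ℕ) (p : MvPolynomial σ K), p.IsHomogeneous k → e ≠ k → φ p = 0 :=
    fun k p hp hk => by simp [φ, homogeneousComponent_of_mem hp, hk]
  -- The Bezoutian.
  choose b hb hbe using fun i => exists_dividedDifference (f i) m (hf i).totalDegree_le
  obtain ⟨q, -, hq⟩ := exists_dividedDifference g e hg.totalDegree_le
  let B := Matrix.of b
  have hBv : ∀ i, (B.mulVec fun j => X j - C (X j)) i = map C (f i) - C (f i) :=
    fun i => (hbe i).symm
  have hB0 : extendFunctional φ B.det = 0 :=
    extendFunctional_eq_zero_of_totalDegree_le φ (Fintype.card σ * (m - 1))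
      (fun s hs => hφhom _ _ (isHomogeneous_monomial 1 rfl) (by omega)) _
      (totalDegree_det_le B (m - 1) fun i j => hb i j)
  have hBg : extendFunctional φ (map C g * B.det) = constantCoeff B.det :=
    extendFunctional_map_mul_eq_constantCoeff φ g hφg (fun s hs =>
      hφhom _ _ (hg.mul (isHomogeneous_monomial 1 rfl)) (by
        have : s.degree ≠ 0 := mt (Finsupp.degree_eq_zero_iff s).mp hs
        omega)) _
  have hmem : extendFunctional φ ((map C g - C g) * B.det) ∈ Ideal.span (Set.range f) := by
    rw [hq, Finset.sum_mul, map_sum]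
    refine Ideal.sum_mem _ fun j _ => ?_
    rw [mul_assoc, mul_comm _ B.det, det_mul_eq_sum_adjugate B (fun j => X j - C (X j)),
      Finset.mul_sum, map_sum]
    refine Ideal.sum_mem _ fun i _ => ?_
    have e₁ : q j * (B.adjugate j i * (map C (f i) - C (f i))) =
        map C (f i) * (q j * B.adjugate j i) - f i • (q j * B.adjugate j i) := by
      rw [smul_eq_C_mul]
      ring
    rw [hBv, e₁, map_sub, map_smul, extendFunctional_map_mul_eq_zero, zero_sub, smul_eq_mul]
    · exact neg_mem (Ideal.mul_mem_right _ _ (Ideal.subset_span ⟨i, rfl⟩))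
    · exact fun p => hφI _ (Ideal.mul_mem_right _ _ (Ideal.subset_span ⟨i, rfl⟩))
  rw [sub_mul, map_sub, hBg, ← smul_eq_C_mul, map_smul, hB0, smul_zero, sub_zero,
    RingHom.map_det] at hmem
  -- The Bezoutian at `x = 0`.
  choose k hk using exists_X_pow_mem_span f m hf hfin
  refine det_notMem_span f _ (funext fun i => ?_) (∑ i, k i) (fun i => ?_) hmem
  · have h := congrArg constantCoeff (hbe i)
    have h0 : constantCoeff (f i) = 0 := by
      rw [constantCoeff_eq]
      exact (hf i).coeff_eq_zero (by simp; omega)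
    simp only [map_sub, map_sum, map_mul, constantCoeff_X, constantCoeff_C, constantCoeff_map, h0,
      map_zero, zero_sub, mul_neg, Finset.sum_neg_distrib, neg_inj] at h
    exact h.symm
  · exact Ideal.mem_of_dvd _ (pow_dvd_pow _ (Nat.le_succ_of_le
      (Finset.single_le_sum (fun _ _ => Nat.zero_le _) (Finset.mem_univ i)))) (hk i)

end Bound

end Macaulay

/-- Macaulay's bound: if `f` is homogeneous of degree `d ≥ 2` in `n+1` variables and
its Jacobian ideal has finite codimension (Hypothesis (H)), then every homogeneous
polynomial of degree at least `(n+1)(d−2)+1` lies in the Jacobian ideal. -/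
theorem macaulay_bound {L : Type*} [Field L] [CharZero L]
    (n : ℕ) (hn : 1 ≤ n) (d : ℕ) (hd : 2 ≤ d)
    (f : MvPolynomial (Fin (n + 1)) L) (hf : f.IsHomogeneous d)
    (hH : Module.Finite L
      (MvPolynomial (Fin (n + 1)) L ⧸
        Ideal.span (Set.range fun i : Fin (n + 1) => pderiv i f))) :
    ∀ e : ℕ, (n + 1) * (d - 2) + 1 ≤ e →
      ∀ g : MvPolynomial (Fin (n + 1)) L, g.IsHomogeneous e →
        g ∈ Ideal.span (Set.range fun i : Fin (n + 1) => pderiv i f) := by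
  intro e he g hg
  refine Macaulay.mem_span_of_isHomogeneous _ (d - 1) (by omega) (fun i => hf.pderiv) hH e ?_ g hg
  rw [Fintype.card_fin, Nat.sub_sub]
  exact he
end

section
/- Let L be a field of characteristic zero, let n ≥ 1, and let f ∈ L[x_0,…,x_n] be a homogeneous polynomial of degree d ≥ 2 satisfying Hypothesis (H). For l ≥ 1, let A_l denote the L-subspace of L[x_0,…,x_n]/Jac f that is the image of the homogeneous polynomials of degree l·d − (n+1). Then Σ_{l=1}^{n} dim_L A_l = ((d−1)^{n+1} + (−1)^{n+1}(d−1))/d. -/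
open MvPolynomial

universe u

section RegularSequences

open CategoryTheory Abelian Pointwise RingTheory.Sequence

theorem ext_subsingleton_of_quotSMulTop {R : Type u} [CommRing R] (N M : ModuleCat.{u} R) {a : R}
    (ha : IsSMulRegular M a) (hN : a ∈ Module.annihilator R N) (r : ℕ)
    (h : ∀ i < r, Subsingleton (Ext N (ModuleCat.of R (QuotSMulTop a M)) i)) :
    ∀ i < r + 1, Subsingleton (Ext N M i) := by
  have hS := ha.smulShortComplex_shortExact
  intro i hi
  refine subsingleton_of_forall_eq 0 fun x => ?_
  have hax : x.comp (Ext.mk₀ (a • 𝟙 M)) (add_zero i) = 0 := by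
    have h0 : a • 𝟙 N = 0 := by
      ext y
      exact Module.mem_annihilator.mp hN y
    rw [← Ext.smul_eq_comp_mk₀, ← Ext.mk₀_id_comp x, ← Ext.smul_comp, ← Ext.mk₀_smul, h0,
      Ext.mk₀_zero, Ext.zero_comp]
  have hx : x.comp (Ext.mk₀ (M.smulShortComplex a).f) (add_zero i) = 0 := hax
  cases i with
  | zero =>
    have := hS.mono_f
    refine Ext.postcomp_mk₀_injective_of_mono N (M.smulShortComplex a).f ?_
    exact hx.trans (map_zero ((Ext.mk₀ (M.smulShortComplex a).f).postcomp N (add_zero 0))).symm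
  | succ i =>
    obtain ⟨y, rfl⟩ := Ext.covariant_sequence_exact₁ N hS x hx rfl
    have : Subsingleton (Ext N (M.smulShortComplex a).X₃ i) := h i (by omega)
    rw [Subsingleton.elim y 0, Ext.zero_comp]
    rfl

theorem ext_quotSMulTop_subsingleton {R : Type u} [CommRing R] (N M : ModuleCat.{u} R) {a : R}
    (ha : IsSMulRegular M a) (r : ℕ) (h : ∀ i < r + 1, Subsingleton (Ext N M i)) :
    ∀ i < r, Subsingleton (Ext N (ModuleCat.of R (QuotSMulTop a M)) i) := by
  have hS := ha.smulShortComplex_shortExact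
  intro i hi
  refine subsingleton_of_forall_eq 0 fun x => ?_
  have h1 : Subsingleton (Ext N (M.smulShortComplex a).X₁ (i + 1)) := h (i + 1) (by omega)
  have h2 : Subsingleton (Ext N (M.smulShortComplex a).X₂ i) := h i (by omega)
  obtain ⟨y, rfl⟩ := Ext.covariant_sequence_exact₃ N hS x rfl (Subsingleton.elim _ _)
  rw [Subsingleton.elim y 0, Ext.zero_comp]
  rfl

theorem ext_subsingleton_of_isWeaklyRegular {R : Type u} [CommRing R] (N : ModuleCat.{u} R)
    (rs : List R) (hN : ∀ a ∈ rs, a ∈ Module.annihilator R N) (M : ModuleCat.{u} R)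
    (h : IsWeaklyRegular M rs) : ∀ i < rs.length, Subsingleton (Ext N M i) := by
  induction rs generalizing M with
  | nil => simp
  | cons a rs ih =>
    rw [isWeaklyRegular_cons_iff] at h
    exact ext_subsingleton_of_quotSMulTop N M h.1 (hN a (by simp)) _
      (ih (fun b hb => hN b (by simp [hb])) (ModuleCat.of R (QuotSMulTop a M)) h.2)

theorem linearMap_quotient_subsingleton_of_ext {R : Type u} [CommRing R] (N : ModuleCat.{u} R)
    (rs : List R) (M : ModuleCat.{u} R) (h : IsWeaklyRegular M rs)
    (hE : ∀ i < rs.length + 1, Subsingleton (Ext N M i)) :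
    Subsingleton (N →ₗ[R] (M ⧸ (Ideal.ofList rs • ⊤ : Submodule R M))) := by
  induction rs generalizing M with
  | nil =>
    have := hE 0 (by simp)
    have e : (N →ₗ[R] M) ≃ Ext N M 0 := ModuleCat.homEquiv.symm.trans Ext.homEquiv₀.symm
    have e' := Submodule.quotEquivOfEqBot (Ideal.ofList ([] : List R) • ⊤ : Submodule R M) (by simp)
    exact ((LinearEquiv.congrRight (M := N) e').toEquiv.trans e).subsingleton
  | cons a rs ih =>
    rw [isWeaklyRegular_cons_iff] at h
    have := ih (ModuleCat.of R (QuotSMulTop a M)) h.2 (ext_quotSMulTop_subsingleton N M h.1 _ hE)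
    exact (LinearEquiv.congrRight (M := N)
      (Submodule.quotOfListConsSMulTopEquivQuotSMulTopInner M a rs)).toEquiv.subsingleton

theorem isWeaklyRegular_concat_iff {R : Type*} [CommRing R] (rs : List R) (h : R) :
    IsWeaklyRegular R (rs ++ [h]) ↔
      IsWeaklyRegular R rs ∧ ∀ p, h * p ∈ Ideal.ofList rs → p ∈ Ideal.ofList rs := by
  rw [isWeaklyRegular_append_iff, isWeaklyRegular_singleton_iff,
    isSMulRegular_quotient_iff_mem_of_smul_mem]
  simp

theorem MvPolynomial.isWeaklyRegular_map_X {σ K : Type*} [Field K] (is : List σ)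
    (his : is.Nodup) :
    IsWeaklyRegular (MvPolynomial σ K) (is.map (X : σ → MvPolynomial σ K)) := by
  induction is using List.reverseRecOn with
  | nil => simp
  | append_singleton is i ih =>
    rw [List.map_append, List.map_singleton, isWeaklyRegular_concat_iff]
    rw [List.nodup_append] at his
    refine ⟨ih his.1, fun p hp => ?_⟩
    have hI : Ideal.ofList (is.map (X : σ → MvPolynomial σ K)) =
        Ideal.span (Set.image X {j | j ∈ is}) := by
      unfold Ideal.ofList
      congr 1
      ext; simp
    rw [hI, mem_ideal_span_X_image] at hp ⊢
    intro m hm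
    obtain ⟨j, hj, hmj⟩ := hp (m + Finsupp.single i 1) (by
      rw [mem_support_iff] at hm ⊢
      rwa [mul_comm, coeff_mul_X])
    refine ⟨j, hj, ?_⟩
    have hij : i ≠ j := fun h => his.2.2 j hj i (by simp) h.symm
    simpa [Finsupp.single_apply, hij] using hmj

attribute [local instance] MvPolynomial.gradedAlgebra

theorem MvPolynomial.isHomogeneous_span {σ K : Type*} [Field K] {e : ℕ}
    {s : Set (MvPolynomial σ K)} (hs : ∀ p ∈ s, p.IsHomogeneous e) :
    (Ideal.span s).IsHomogeneous (homogeneousSubmodule σ K) :=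
  Ideal.homogeneous_span _ _ fun p hp => ⟨e, hs p hp⟩

theorem MvPolynomial.exists_X_pow_mem {σ K : Type*} [Field K] {I : Ideal (MvPolynomial σ K)}
    (hI : I.IsHomogeneous (homogeneousSubmodule σ K))
    (hfin : Module.Finite K (MvPolynomial σ K ⧸ I)) (i : σ) :
    ∃ k : ℕ, (X i : MvPolynomial σ K) ^ k ∈ I := by
  obtain ⟨p, hp0, hp⟩ := Algebra.IsAlgebraic.isAlgebraic (R := K)
    (Ideal.Quotient.mkₐ K I (X i))
  rw [Polynomial.aeval_algHom_apply, Ideal.Quotient.mkₐ_eq_mk, Ideal.Quotient.eq_zero_iff_mem]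
    at hp
  refine ⟨p.natDegree, ?_⟩
  have h := homogeneousComponent_mem_of_mem hI hp p.natDegree
  rw [Polynomial.aeval_eq_sum_range, map_sum, Finset.sum_eq_single p.natDegree] at h
  · rw [map_smul, homogeneousComponent_eq_self (isHomogeneous_X_pow i _), smul_eq_C_mul] at h
    have hu : IsUnit (C p.leadingCoeff : MvPolynomial σ K) :=
      (isUnit_iff_ne_zero.mpr (by simpa using hp0)).map C
    exact (Ideal.unit_mul_mem_iff_mem I hu).mp h
  · intro k _ hk
    rw [map_smul, homogeneousComponent_of_mem (isHomogeneous_X_pow i k), if_neg hk.symm, smul_zero]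
  · simp

theorem MvPolynomial.exists_isWeaklyRegular_of_finite_quotient {K : Type u} [Field K] [Infinite K]
    {n : ℕ} (V : Submodule K (MvPolynomial (Fin n) K))
    (hI : (Ideal.span (V : Set (MvPolynomial (Fin n) K))).IsHomogeneous
      (homogeneousSubmodule (Fin n) K))
    (hfin : Module.Finite K (MvPolynomial (Fin n) K ⧸ Ideal.span (V : Set (MvPolynomial (Fin n) K))))
    (rs : List (MvPolynomial (Fin n) K)) (hrs : IsWeaklyRegular (MvPolynomial (Fin n) K) rs)
    (hlen : rs.length < n) :
    ∃ h ∈ V, IsWeaklyRegular (MvPolynomial (Fin n) K) (rs ++ [h]) := by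
  let S := MvPolynomial (Fin n) K
  let M := S ⧸ (Ideal.ofList rs • ⊤ : Submodule S S)
  have hfinite := associatedPrimes.finite S M
  by_contra! hcon
  have hcover : ⋃ Q : associatedPrimes S M,
      (((Q : Ideal S).restrictScalars K).comap V.subtype : Set V) = Set.univ := by
    refine Set.eq_univ_of_forall fun v => ?_
    have hv : ¬ IsSMulRegular M (v : S) := by
      intro hv
      refine hcon v v.2 ?_
      rw [isWeaklyRegular_append_iff, isWeaklyRegular_singleton_iff]
      exact ⟨hrs, hv⟩
    have hv' : (v : S) ∈ ⋃ p ∈ associatedPrimes S M, (p : Set S) := by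
      rw [biUnion_associatedPrimes_eq_compl_regular S M]
      exact hv
    simpa using hv'
  have := hfinite.to_subtype
  obtain ⟨⟨Q, hQ⟩, hQV⟩ := Subspace.exists_eq_top_of_iUnion_eq_univ hcover
  have hVQ : Ideal.span (V : Set S) ≤ Q := by
    refine Ideal.span_le.mpr fun v hv => ?_
    have : (⟨v, hv⟩ : V) ∈ ((Q.restrictScalars K).comap V.subtype) := hQV ▸ Submodule.mem_top
    exact this
  obtain ⟨hQp, f, hf⟩ := (isAssociatedPrime_iff_exists_injective_linearMap Q M).mp hQ
  have hXQ : ∀ i, (X i : S) ∈ Q := fun i => by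
    obtain ⟨k, hk⟩ := exists_X_pow_mem hI hfin i
    exact hQp.mem_of_pow_mem k (hVQ hk)
  have hext := ext_subsingleton_of_isWeaklyRegular (ModuleCat.of S (S ⧸ Q))
    ((List.finRange n).map X) (by simpa [Ideal.annihilator_quotient] using hXQ)
    (ModuleCat.of S S) (isWeaklyRegular_map_X _ (List.nodup_finRange n))
  have hsub := linearMap_quotient_subsingleton_of_ext (ModuleCat.of S (S ⧸ Q)) rs
    (ModuleCat.of S S) hrs (fun i hi => hext i (by simp; omega))
  have hf0 : f = 0 := hsub.elim f 0
  have : Nontrivial (S ⧸ Q) := Ideal.Quotient.nontrivial_iff.mpr hQp.ne_top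
  exact one_ne_zero (hf (by rw [hf0]; rfl : f 1 = f 0))

theorem MvPolynomial.exists_isWeaklyRegular_span_eq {K : Type u} [Field K] [Infinite K]
    {n e : ℕ} (he : e ≠ 0) (g : Fin n → MvPolynomial (Fin n) K) (hg : ∀ i, (g i).IsHomogeneous e)
    (hfin : Module.Finite K (MvPolynomial (Fin n) K ⧸ Ideal.span (Set.range g))) :
    ∃ rs : List (MvPolynomial (Fin n) K), rs.length = n ∧ (∀ r ∈ rs, r.IsHomogeneous e) ∧
      IsWeaklyRegular (MvPolynomial (Fin n) K) rs ∧ Ideal.ofList rs = Ideal.span (Set.range g) := by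
  let S := MvPolynomial (Fin n) K
  let V : Submodule K S := Submodule.span K (Set.range g)
  have hVS : Ideal.span (V : Set S) = Ideal.span (Set.range g) :=
    Submodule.span_span_of_tower K S _
  have hVhom : V ≤ homogeneousSubmodule (Fin n) K e := by
    refine Submodule.span_le.mpr ?_
    rintro _ ⟨i, rfl⟩
    exact hg i
  have hne : Ideal.span (V : Set S) ≠ ⊤ := by
    have hle : Ideal.span (V : Set S) ≤ RingHom.ker (constantCoeff (σ := Fin n) (R := K)) := by
      refine Ideal.span_le.mpr fun v hv => ?_
      exact (hVhom hv).coeff_eq_zero (by simpa using he.symm)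
    intro h
    rw [h] at hle
    simpa using hle (Submodule.mem_top (x := (1 : S)))
  have hI : (Ideal.span (V : Set S)).IsHomogeneous (homogeneousSubmodule (Fin n) K) :=
    isHomogeneous_span fun p hp => hVhom hp
  have key : ∀ k ≤ n, ∃ rs : List S, rs.length = k ∧ (∀ r ∈ rs, r ∈ V) ∧
      IsWeaklyRegular S rs ∧ k ≤ Module.finrank K (Submodule.span K {r | r ∈ rs}) := by
    intro k
    induction k with
    | zero => exact fun _ => ⟨[], by simp⟩
    | succ k ih =>
      intro hk
      obtain ⟨rs, hlen, hrsV, hreg, hrank⟩ := ih (by omega)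
      obtain ⟨h, hhV, hh⟩ := exists_isWeaklyRegular_of_finite_quotient V hI (hVS ▸ hfin) rs hreg
        (by omega)
      refine ⟨rs ++ [h], by simp [hlen], ?_, hh, ?_⟩
      · simp only [List.mem_append, List.mem_singleton]
        rintro r (hr | rfl)
        exacts [hrsV r hr, hhV]
      have hnot : h ∉ Submodule.span K {r | r ∈ rs} := by
        intro hmem
        have h1 : h ∈ Ideal.ofList rs := Submodule.span_subset_span K S _ hmem
        have h2 := ((isWeaklyRegular_concat_iff rs h).mp hh).2 1 (by simpa using h1)
        refine hne ((Ideal.eq_top_iff_one _).mpr (Ideal.span_mono ?_ h2))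
        exact fun r hr => hrsV r hr
      have hfd : FiniteDimensional K (Submodule.span K {r | r ∈ rs ++ [h]}) :=
        FiniteDimensional.span_of_finite K (List.finite_toSet _)
      refine Nat.succ_le_of_lt (hrank.trans_lt (Submodule.finrank_lt_finrank_of_lt ?_))
      refine lt_of_le_of_ne (Submodule.span_mono fun r hr => ?_) fun heq => hnot ?_
      · exact List.mem_append_left _ hr
      · rw [heq]
        exact Submodule.subset_span (by simp)
  obtain ⟨rs, hlen, hrsV, hreg, hrank⟩ := key n le_rfl
  refine ⟨rs, hlen, fun r hr => hVhom (hrsV r hr), hreg, ?_⟩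
  have hVfd : FiniteDimensional K V := FiniteDimensional.span_of_finite K (Set.finite_range g)
  have hle : Submodule.span K {r | r ∈ rs} ≤ V := Submodule.span_le.mpr hrsV
  have hVrank : Module.finrank K V ≤ n := 
    (finrank_range_le_card (R := K) g).trans_eq (Fintype.card_fin n)
  have heq := Submodule.eq_of_le_of_finrank_le hle (hVrank.trans hrank)
  rw [← hVS, ← heq]
  exact (Submodule.span_span_of_tower K S _).symm

section HilbertSeries

variable {σ K : Type*} [Field K]

/-- The image in `K[x]/I` of the homogeneous polynomials of degree `k`. -/
noncomputable def MvPolynomial.quotientComponent (I : Ideal (MvPolynomial σ K)) (k : ℕ) :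
    Submodule K (MvPolynomial σ K ⧸ I) :=
  Submodule.map (Ideal.Quotient.mkₐ K I).toLinearMap (homogeneousSubmodule σ K k)

theorem MvPolynomial.mk_mem_quotientComponent {I : Ideal (MvPolynomial σ K)} {k : ℕ}
    {p : MvPolynomial σ K} (hp : p.IsHomogeneous k) :
    Ideal.Quotient.mk I p ∈ quotientComponent I k :=
  ⟨p, hp, rfl⟩

theorem MvPolynomial.exists_of_mem_quotientComponent {I : Ideal (MvPolynomial σ K)} {k : ℕ}
    {x : MvPolynomial σ K ⧸ I} (hx : x ∈ quotientComponent I k) :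
    ∃ p : MvPolynomial σ K, p.IsHomogeneous k ∧ Ideal.Quotient.mk I p = x :=
  hx

/-- The Hilbert series of `K[x]/I`, meaningful when `I` is homogeneous. -/
noncomputable def MvPolynomial.quotientHilbertSeries (I : Ideal (MvPolynomial σ K)) :
    PowerSeries ℤ :=
  PowerSeries.mk fun k => (Module.finrank K (quotientComponent I k) : ℤ)

instance MvPolynomial.finiteDimensional_quotientComponent [Finite σ]
    (I : Ideal (MvPolynomial σ K)) (k : ℕ) : FiniteDimensional K (quotientComponent I k) :=
  Module.Finite.iff_fg.mpr ((homogeneousSubmodule_fg σ K k).map _)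

theorem MvPolynomial.homogeneousComponent_mul_of_isHomogeneous {h : MvPolynomial σ K} {e : ℕ}
    (hh : h.IsHomogeneous e) (p : MvPolynomial σ K) (k : ℕ) :
    homogeneousComponent k (h * p) = if e ≤ k then h * homogeneousComponent (k - e) p else 0 := by
  have key := DirectSum.coe_decompose_mul_of_left_mem (homogeneousSubmodule σ K) k
    (b := p) (show h ∈ homogeneousSubmodule σ K e from hh)
  have hdec : ∀ (q : MvPolynomial σ K) (j : ℕ),
      (DirectSum.decompose (homogeneousSubmodule σ K) q j : MvPolynomial σ K) =
        homogeneousComponent j q := decomposition.decompose'_apply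
  simpa only [hdec] using key

theorem MvPolynomial.finrank_quotientComponent_sup_span_singleton [Finite σ]
    {I : Ideal (MvPolynomial σ K)} (hI : I.IsHomogeneous (homogeneousSubmodule σ K))
    {h : MvPolynomial σ K} {e : ℕ} (hh : h.IsHomogeneous e) (hreg : ∀ p, h * p ∈ I → p ∈ I)
    (k : ℕ) :
    (Module.finrank K (quotientComponent I k) : ℤ) =
      Module.finrank K (quotientComponent (I ⊔ Ideal.span {h}) k) +
        if e ≤ k then (Module.finrank K (quotientComponent I (k - e)) : ℤ) else 0 := by
  let q : (MvPolynomial σ K ⧸ I) →ₐ[K] (MvPolynomial σ K ⧸ (I ⊔ Ideal.span {h})) :=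
    Ideal.Quotient.factorₐ K le_sup_left
  have hmem : ∀ p : MvPolynomial σ K, p.IsHomogeneous k → p ∈ I ⊔ Ideal.span {h} →
      ∃ c, p - (if e ≤ k then h * homogeneousComponent (k - e) c else 0) ∈ I := by
    intro p hp hpI
    obtain ⟨i, hi, x, hx, hix⟩ := Submodule.mem_sup.mp hpI
    obtain ⟨c, rfl⟩ := Ideal.mem_span_singleton'.mp hx
    refine ⟨c, ?_⟩
    have := homogeneousComponent_mem_of_mem hI hi k
    rwa [eq_sub_of_add_eq hix, map_sub, homogeneousComponent_eq_self hp, mul_comm c h,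
      homogeneousComponent_mul_of_isHomogeneous hh] at this
  let q' := q.toLinearMap.domRestrict (quotientComponent I k)
  have hrank := q'.finrank_range_add_finrank_ker
  have hrange : LinearMap.range q' = quotientComponent (I ⊔ Ideal.span {h}) k := by
    rw [LinearMap.range_domRestrict, quotientComponent, quotientComponent, ← Submodule.map_comp]
    rfl
  rw [hrange] at hrank
  rw [← hrank, Nat.cast_add]
  congr 1
  split_ifs with hek
  · let μ : (MvPolynomial σ K ⧸ I) →ₗ[K] (MvPolynomial σ K ⧸ I) :=
      LinearMap.mulLeft K (Ideal.Quotient.mk I h)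
    have hμ : Function.Injective μ := by
      rw [← LinearMap.ker_eq_bot, LinearMap.ker_eq_bot']
      intro x hx
      obtain ⟨p, rfl⟩ := Ideal.Quotient.mk_surjective x
      rw [LinearMap.mulLeft_apply, ← map_mul, Ideal.Quotient.eq_zero_iff_mem] at hx
      exact Ideal.Quotient.eq_zero_iff_mem.mpr (hreg p hx)
    have hker : (LinearMap.ker q').map (quotientComponent I k).subtype =
        (quotientComponent I (k - e)).map μ := by
      ext x
      constructor
      · rintro ⟨⟨_, hx⟩, hxq, rfl⟩
        obtain ⟨p, hp, rfl⟩ := exists_of_mem_quotientComponent hx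
        have hpI : p ∈ I ⊔ Ideal.span {h} := Ideal.Quotient.eq_zero_iff_mem.mp hxq
        obtain ⟨c, hc⟩ := hmem p hp hpI
        rw [if_pos hek, ← Ideal.Quotient.eq] at hc
        refine ⟨_, mk_mem_quotientComponent (homogeneousComponent_isHomogeneous (k - e) c), ?_⟩
        exact ((map_mul _ _ _).symm.trans hc.symm)
      · rintro ⟨_, hy, rfl⟩
        obtain ⟨p, hp, rfl⟩ := exists_of_mem_quotientComponent hy
        have hhp : (h * p).IsHomogeneous k := by
          simpa [Nat.add_sub_cancel' hek] using hh.mul hp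
        refine ⟨⟨_, mk_mem_quotientComponent hhp⟩, ?_, map_mul (Ideal.Quotient.mk I) h p⟩
        refine Ideal.Quotient.eq_zero_iff_mem.mpr (Ideal.mul_mem_right _ _ ?_)
        exact Ideal.mem_sup_right (Ideal.mem_span_singleton_self h)
    rw [(Submodule.equivMapOfInjective μ hμ _).finrank_eq, ← hker,
      ← (Submodule.equivMapOfInjective _ (Submodule.subtype_injective _) _).finrank_eq]
  · rw [Nat.cast_eq_zero, Submodule.finrank_eq_zero, LinearMap.ker_eq_bot']
    rintro ⟨_, hx⟩ hxq
    obtain ⟨p, hp, rfl⟩ := exists_of_mem_quotientComponent hx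
    obtain ⟨c, hc⟩ := hmem p hp (Ideal.Quotient.eq_zero_iff_mem.mp hxq)
    rw [if_neg hek, sub_zero] at hc
    exact Subtype.ext (Ideal.Quotient.eq_zero_iff_mem.mpr hc)

theorem MvPolynomial.quotientHilbertSeries_ofList [Finite σ] {e : ℕ}
    (rs : List (MvPolynomial σ K)) (hrs : ∀ r ∈ rs, r.IsHomogeneous e)
    (hreg : IsWeaklyRegular (MvPolynomial σ K) rs) :
    quotientHilbertSeries (Ideal.ofList rs) =
      (1 - PowerSeries.X ^ e) ^ rs.length *
        quotientHilbertSeries (⊥ : Ideal (MvPolynomial σ K)) := by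
  induction rs using List.reverseRecOn with
  | nil => simp
  | append_singleton rs h ih =>
    rw [isWeaklyRegular_concat_iff] at hreg
    have hI : (Ideal.ofList rs).IsHomogeneous (homogeneousSubmodule σ K) :=
      isHomogeneous_span fun r hr => hrs r (List.mem_append_left _ hr)
    rw [List.length_append, List.length_singleton, pow_succ', mul_assoc,
      ← ih (fun r hr => hrs r (List.mem_append_left _ hr)) hreg.1, Ideal.ofList_append,
      Ideal.ofList_singleton]
    ext k
    have := finrank_quotientComponent_sup_span_singleton hI (hrs h (by simp)) hreg.2 k
    simp only [sub_mul, one_mul, map_sub, PowerSeries.coeff_X_pow_mul', quotientHilbertSeries,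
      PowerSeries.coeff_mk]
    rw [this]
    ring

theorem MvPolynomial.quotientHilbertSeries_ofList_X {n : ℕ} :
    quotientHilbertSeries (Ideal.ofList ((List.finRange n).map
      (X : Fin n → MvPolynomial (Fin n) K))) = 1 := by
  have hI : Ideal.ofList ((List.finRange n).map (X : Fin n → MvPolynomial (Fin n) K)) =
      Ideal.span (Set.image X Set.univ) := by
    unfold Ideal.ofList
    congr 1
    ext; simp
  rw [hI]
  ext k
  rw [quotientHilbertSeries, PowerSeries.coeff_mk, PowerSeries.coeff_one]
  split_ifs with hk
  · subst hk
    have hone : quotientComponent (Ideal.span (Set.image X Set.univ) : Ideal (MvPolynomial (Fin n) K)) 0 =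
        Submodule.span K {1} := by
      rw [quotientComponent, homogeneousSubmodule_zero, Submodule.one_eq_span, Submodule.map_span]
      simp
    have hne : (1 : MvPolynomial (Fin n) K ⧸
        (Ideal.span (Set.image X Set.univ) : Ideal (MvPolynomial (Fin n) K))) ≠ 0 := by
      rw [← map_one (Ideal.Quotient.mk _), Ne, Ideal.Quotient.eq_zero_iff_mem,
        mem_ideal_span_X_image]
      intro h
      obtain ⟨i, -, hi⟩ := h 0 (by simp)
      simp at hi
    rw [hone, finrank_span_singleton hne, Nat.cast_one]
  · rw [Nat.cast_eq_zero, Submodule.finrank_eq_zero, Submodule.eq_bot_iff]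
    intro x hx
    obtain ⟨p, hp, rfl⟩ := exists_of_mem_quotientComponent hx
    rw [Ideal.Quotient.eq_zero_iff_mem, mem_ideal_span_X_image]
    intro m hm
    by_contra! hcon
    have hm0 : m = 0 := by
      ext i
      simpa using hcon i (Set.mem_univ i)
    refine mem_support_iff.mp hm (hp.coeff_eq_zero ?_)
    simpa [hm0] using Ne.symm hk

end HilbertSeries

theorem MvPolynomial.quotientHilbertSeries_eq_of_finite_quotient {K : Type u} [Field K] [Infinite K]
    {n e : ℕ} (he : e ≠ 0) (g : Fin n → MvPolynomial (Fin n) K) (hg : ∀ i, (g i).IsHomogeneous e)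
    (hfin : Module.Finite K (MvPolynomial (Fin n) K ⧸ Ideal.span (Set.range g))) :
    quotientHilbertSeries (Ideal.span (Set.range g)) =
      (∑ i ∈ Finset.range e, (PowerSeries.X : PowerSeries ℤ) ^ i) ^ n := by
  obtain ⟨rs, hlen, hhom, hreg, hspan⟩ := exists_isWeaklyRegular_span_eq he g hg hfin
  have h1 := quotientHilbertSeries_ofList rs hhom hreg
  have h2 := quotientHilbertSeries_ofList (e := 1) _
    (by simpa using isHomogeneous_X K)
    (isWeaklyRegular_map_X (K := K) _ (List.nodup_finRange n))
  rw [quotientHilbertSeries_ofList_X, List.length_map, List.length_finRange, pow_one] at h2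
  rw [hspan, hlen, ← mul_neg_geom_sum, mul_pow, mul_right_comm, ← h2, one_mul] at h1
  exact h1

end RegularSequences

section SumCoeffDvd

open Polynomial

/-- The sum of the coefficients of `p` in degrees divisible by `d`. -/
noncomputable def Polynomial.sumCoeffDvd (d : ℕ) : ℤ[X] →ₗ[ℤ] ℤ :=
  Polynomial.lsum fun k => if d ∣ k then LinearMap.id else 0

theorem Polynomial.sumCoeffDvd_X_pow (d k : ℕ) :
    sumCoeffDvd d (X ^ k) = if d ∣ k then 1 else 0 := by
  rw [sumCoeffDvd, lsum_apply, ← monomial_one_right_eq_X_pow, sum_monomial_index]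
  · split_ifs <;> simp
  · simp

theorem Polynomial.sumCoeffDvd_mul_geom_sum {d : ℕ} (hd : d ≠ 0) (p : ℤ[X]) :
    sumCoeffDvd d (p * ∑ i ∈ Finset.range d, X ^ i) = p.eval 1 := by
  have key : ∀ k, sumCoeffDvd d (X ^ k * ∑ i ∈ Finset.range d, X ^ i) = 1 := by
    intro k
    induction k with
    | zero =>
      simp only [pow_zero, one_mul, map_sum, sumCoeffDvd_X_pow]
      rw [Finset.sum_eq_single 0]
      · simp
      · intro b hb hb0
        exact if_neg fun h => hb0 (Nat.eq_zero_of_dvd_of_lt h (Finset.mem_range.mp hb))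
      · simp [hd]
    | succ k ih =>
      have h : (X : ℤ[X]) ^ (k + 1) * ∑ i ∈ Finset.range d, X ^ i =
          X ^ k * ∑ i ∈ Finset.range d, X ^ i + X ^ (k + d) - X ^ k := by
        have := geom_sum_mul (X : ℤ[X]) d
        rw [pow_add X k d]
        linear_combination (X : ℤ[X]) ^ k * this
      rw [h, map_sub, map_add, ih, sumCoeffDvd_X_pow, sumCoeffDvd_X_pow]
      simp
  induction p using Polynomial.induction_on' with
  | add p q hp hq => rw [add_mul, map_add, hp, hq, eval_add]
  | monomial k a =>
    rw [← smul_X_eq_monomial, smul_mul_assoc, map_smul, key]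
    simp

theorem Polynomial.mul_sumCoeffDvd_pow {d : ℕ} (hd : d ≠ 0) (m : ℕ) :
    d * sumCoeffDvd d ((∑ i ∈ Finset.range d, X ^ i - 1) ^ m) =
      ((d : ℤ) - 1) ^ m + (-1) ^ m * ((d : ℤ) - 1) := by
  induction m with
  | zero =>
    have := sumCoeffDvd_X_pow d 0
    simp_all
  | succ m ih =>
    rw [pow_succ, mul_sub_one, map_sub, sumCoeffDvd_mul_geom_sum hd, mul_sub, ih]
    simp only [eval_pow, eval_sub, eval_finsetSum, eval_X, one_pow, Finset.sum_const,
      Finset.card_range, nsmul_eq_mul, mul_one, eval_one]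
    ring

theorem Polynomial.sumCoeffDvd_eq_sum_Icc {d n : ℕ} (hd : d ≠ 0) (p : ℤ[X]) (hp0 : p.coeff 0 = 0)
    (hp : p.natDegree < (n + 1) * d) :
    sumCoeffDvd d p = ∑ l ∈ Finset.Icc 1 n, p.coeff (l * d) := by
  rw [sumCoeffDvd, lsum_apply, sum_over_range' _ (by simp) _ hp]
  have h1 : ∀ k, (if d ∣ k then LinearMap.id else 0 : ℤ →ₗ[ℤ] ℤ) (p.coeff k) =
      if d ∣ k then p.coeff k else 0 := by
    intro k
    split_ifs <;> rfl
  simp only [h1]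
  rw [← Finset.sum_filter]
  symm
  have h2 : ∑ l ∈ Finset.Icc 1 n, p.coeff (l * d) = ∑ l ∈ Finset.range (n + 1), p.coeff (l * d) := by
    refine Finset.sum_subset (fun l hl => ?_) fun l hl hl' => ?_
    · simp at hl ⊢; omega
    · have : l = 0 := by simp at hl hl'; omega
      simp [this, hp0]
  rw [h2]
  refine Finset.sum_bij (fun l _ => l * d) (fun l hl => ?_) (fun a _ b _ hab => ?_)
    (fun k hk => ?_) fun _ _ => rfl
  · simp only [Finset.mem_filter, Finset.mem_range] at hl ⊢
    exact ⟨Nat.mul_lt_mul_of_pos_right hl (Nat.pos_of_ne_zero hd), dvd_mul_left d l⟩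
  · exact Nat.eq_of_mul_eq_mul_right (Nat.pos_of_ne_zero hd) hab
  · simp only [Finset.mem_filter, Finset.mem_range] at hk
    obtain ⟨hk, l, rfl⟩ := hk
    refine ⟨l, Finset.mem_range.mpr ?_, mul_comm l d⟩
    rw [mul_comm] at hk
    exact Nat.lt_of_mul_lt_mul_right hk

theorem Polynomial.sum_coeff_geom_sum_pow {d : ℕ} (hd : 2 ≤ d) (n : ℕ) :
    ∑ l ∈ Finset.Icc 1 n, (if n + 1 ≤ l * d then
        ((∑ i ∈ Finset.range (d - 1), (X : ℤ[X]) ^ i) ^ (n + 1)).coeff (l * d - (n + 1)) else 0) =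
      (((d : ℤ) - 1) ^ (n + 1) + (-1) ^ (n + 1) * ((d : ℤ) - 1)) / d := by
  obtain ⟨e, rfl⟩ : ∃ e, d = e + 1 := ⟨d - 1, by omega⟩
  have hG : (∑ i ∈ Finset.range (e + 1), (X : ℤ[X]) ^ i - 1) ^ (n + 1) =
      (∑ i ∈ Finset.range e, (X : ℤ[X]) ^ i) ^ (n + 1) * X ^ (n + 1) := by
    rw [Finset.sum_range_succ', pow_zero, add_sub_cancel_right, ← mul_pow, Finset.sum_mul]
    rfl
  have hdeg : ((∑ i ∈ Finset.range (e + 1), (X : ℤ[X]) ^ i - 1) ^ (n + 1)).natDegree <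
      (n + 1) * (e + 1) := by
    refine (natDegree_pow_le_of_le (m := e) (n + 1) ?_).trans_lt (by nlinarith)
    refine (natDegree_sub_le_of_le (natDegree_sum_le_of_forall_le _ _ fun i hi => ?_)
      (natDegree_one.trans_le zero_le)).trans_eq (max_self e)
    rw [natDegree_X_pow]
    exact Nat.lt_succ_iff.mp (Finset.mem_range.mp hi)
  have hsum := sumCoeffDvd_eq_sum_Icc (d := e + 1) (n := n) (by omega) _
    (by rw [hG, coeff_mul_X_pow']; simp) hdeg
  rw [← mul_sumCoeffDvd_pow (by omega), Int.mul_ediv_cancel_left _ (by omega), hsum, hG]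
  simp only [coeff_mul_X_pow', Nat.add_sub_cancel]

end SumCoeffDvd

/-- Dimension of the primitive cohomology basis (Corollary 1): under Hypothesis (H),
the sum over `1 ≤ l ≤ n` of the dimensions of the images `A_l` in `L[x]/Jac f` of
the homogeneous parts of degree `l·d − (n+1)` equals
`((d−1)^{n+1} + (−1)^{n+1}(d−1))/d`. (When `l·d < n+1` the space `A_l` is zero.) -/
theorem dim_milnor_graded_sum {L : Type*} [Field L] [CharZero L]
    (n : ℕ) (hn : 1 ≤ n) (d : ℕ) (hd : 2 ≤ d)
    (f : MvPolynomial (Fin (n + 1)) L) (hf : f.IsHomogeneous d)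
    (J : Ideal (MvPolynomial (Fin (n + 1)) L))
    (hJ : J = Ideal.span (Set.range fun i : Fin (n + 1) => pderiv i f))
    (hH : Module.Finite L (MvPolynomial (Fin (n + 1)) L ⧸ J)) :
    (∑ l ∈ Finset.Icc 1 n,
        (Module.finrank L
          ↥(if n + 1 ≤ l * d then
            Submodule.map (Ideal.Quotient.mkₐ L J).toLinearMap
              (homogeneousSubmodule (Fin (n + 1)) L (l * d - (n + 1)))
          else ⊥) : ℤ))
      = (((d : ℤ) - 1) ^ (n + 1) + (-1) ^ (n + 1) * ((d : ℤ) - 1)) / d := by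
  subst hJ
  have hg : ∀ i, (pderiv i f).IsHomogeneous (d - 1) := fun i => hf.pderiv
  have hH' := quotientHilbertSeries_eq_of_finite_quotient (by omega) _ hg hH
  rw [← Polynomial.sum_coeff_geom_sum_pow hd n]
  refine Finset.sum_congr rfl fun l _ => ?_
  by_cases hl : n + 1 ≤ l * d
  · have hcoeff := congrArg (PowerSeries.coeff (l * d - (n + 1))) hH'
    have hcoe : ((∑ i ∈ Finset.range (d - 1), (Polynomial.X : Polynomial ℤ) ^ i :
        Polynomial ℤ) : PowerSeries ℤ) = ∑ i ∈ Finset.range (d - 1), PowerSeries.X ^ i := by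
      rw [← Polynomial.coeToPowerSeries.ringHom_apply, map_sum]
      simp
    rw [quotientHilbertSeries, PowerSeries.coeff_mk] at hcoeff
    rw [if_pos hl, if_pos hl, ← Polynomial.coeff_coe, Polynomial.coe_pow, hcoe]
    exact hcoeff
  · rw [if_neg hl, if_neg hl, finrank_bot, Nat.cast_zero]
end

section
/- Let L be a field of characteristic zero, let n ≥ 1, and let f ∈ L[x_0,…,x_n] be a homogeneous polynomial of degree d ≥ 2 satisfying Hypothesis (H). Let ℓ ≥ 1 and let a ∈ L[x_0,…,x_n] be homogeneous of degree ℓ·d − (n+1). Then there exist homogeneous polynomials r_1,…,r_n, with r_k of degree k·d − (n+1) (r_k = 0 when this degree is negative), such that a/f^ℓ − Σ_{k=1}^{n} r_k/f^k lies in D_f; explicitly, setting N = max(ℓ, n), there exist m ∈ ℕ and polynomials b_0,…,b_n with (a·f^{N−ℓ} − Σ_{k=1}^{n} r_k·f^{N−k})·f^{m+1} = f^{N}·Σ_{i=0}^n (f·∂_i b_i − m·b_i·∂_i f). (Every fraction of homogeneous degree −(n+1) is equivalent modulo derivatives to one with pole order at most n.) -/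
open MvPolynomial

/-- A finite-avoidance principle: over an infinite field, if a subspace `V` of a Noetherian algebra
is contained in no associated prime of the finitely many quotients `A ⧸ I j`, then some element of
`V` is a nonzerodivisor on all of them. -/
theorem exists_mem_forall_nonzerodivisor {L A ι : Type*} [Field L] [Infinite L] [CommRing A]
    [IsNoetherianRing A] [Algebra L A] [Finite ι] (I : ι → Ideal A) (V : Submodule L A)
    (hV : ∀ j, ∀ P : Ideal A, P.IsPrime → ∀ w, w ∉ I j → (∀ p, p ∈ P ↔ p * w ∈ I j) →
      ∃ v ∈ V, v ∉ P) :
    ∃ v ∈ V, ∀ j, ∀ w, v * w ∈ I j → w ∈ I j := by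
  classical
  have hfin : (⋃ j, associatedPrimes A (A ⧸ I j)).Finite :=
    Set.finite_iUnion fun j => associatedPrimes.finite A (A ⧸ I j)
  let S : Finset (Subspace L V) :=
    hfin.toFinset.image fun P => (P.restrictScalars L).comap V.subtype
  have hS : ⊤ ∉ S := by
    intro htop
    simp only [S, Finset.mem_image, Set.Finite.mem_toFinset, Set.mem_iUnion] at htop
    obtain ⟨P, ⟨j, hP⟩, hPtop⟩ := htop
    obtain ⟨hprime, x, hx⟩ := isAssociatedPrime_iff.mp hP
    obtain ⟨w, rfl⟩ := Ideal.Quotient.mk_surjective x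
    have hmem : ∀ p, p ∈ P ↔ p * w ∈ I j := fun p => by
      rw [hx, Submodule.mem_colon_singleton, Submodule.mem_bot, Algebra.smul_def,
        Ideal.Quotient.algebraMap_eq, ← map_mul, Ideal.Quotient.eq_zero_iff_mem]
    have hw : w ∉ I j := fun h => hprime.ne_top
      ((Ideal.eq_top_iff_one P).mpr ((hmem 1).mpr (by simpa using h)))
    obtain ⟨v, hvV, hvP⟩ := hV j P hprime w hw hmem
    have : (⟨v, hvV⟩ : V) ∈ (P.restrictScalars L).comap V.subtype := hPtop ▸ Submodule.mem_top
    exact hvP this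
  obtain ⟨v, hv⟩ := (Set.ne_univ_iff_exists_notMem _).mp
    (Subspace.biUnion_ne_univ_of_top_notMem hS)
  refine ⟨v, v.2, fun j w hw => by_contra fun hwI => hv ?_⟩
  have hmem : (v : A) ∈ ⋃ p ∈ associatedPrimes A (A ⧸ I j), (p : Set A) := by
    rw [biUnion_associatedPrimes_eq_zero_divisors]
    refine ⟨Ideal.Quotient.mk _ w, by rwa [Ne, Ideal.Quotient.eq_zero_iff_mem], ?_⟩
    rwa [Algebra.smul_def, Ideal.Quotient.algebraMap_eq, ← map_mul,
      Ideal.Quotient.eq_zero_iff_mem]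
  obtain ⟨P, hP, hvP⟩ := Set.mem_iUnion₂.mp hmem
  refine Set.mem_iUnion₂.mpr ⟨_, Finset.mem_image_of_mem _ ?_, hvP⟩
  exact hfin.mem_toFinset.mpr (Set.mem_iUnion.mpr ⟨j, hP⟩)

/-- The ideal generated by the first `k` terms of a sequence. -/
def prefixIdeal {A : Type*} [CommRing A] (f : ℕ → A) (k : ℕ) : Ideal A :=
  Ideal.span (f '' Set.Iio k)

/-- The first `k` terms of `f` form a weakly regular sequence: each `f i` is a nonzerodivisor
modulo the preceding terms. -/
def IsRegularPrefix {A : Type*} [CommRing A] (f : ℕ → A) (k : ℕ) : Prop :=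
  ∀ i < k, ∀ p, f i * p ∈ prefixIdeal f i → p ∈ prefixIdeal f i

section Prefix

variable {A : Type*} [CommRing A] {f : ℕ → A} {k : ℕ}

theorem prefixIdeal_zero : prefixIdeal f 0 = ⊥ := by
  simp [prefixIdeal]

theorem prefixIdeal_mono {i j : ℕ} (h : i ≤ j) : prefixIdeal f i ≤ prefixIdeal f j :=
  Ideal.span_mono (Set.image_mono (Set.Iio_subset_Iio h))

theorem mem_prefixIdeal_succ {p : A} :
    p ∈ prefixIdeal f (k + 1) ↔ ∃ v, p - f k * v ∈ prefixIdeal f k := by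
  have : Set.Iio (k + 1) = insert k (Set.Iio k) := by ext; simp
  rw [prefixIdeal, this, Set.image_insert_eq, Ideal.mem_span_insert']
  exact ⟨fun ⟨a, ha⟩ => ⟨-a, by simpa [mul_comm, prefixIdeal] using ha⟩,
    fun ⟨a, ha⟩ => ⟨-a, by simpa [mul_comm, prefixIdeal, sub_eq_add_neg] using ha⟩⟩

theorem map_prefixIdeal {B : Type*} [CommRing B] (ψ : A →+* B) :
    (prefixIdeal f k).map ψ = prefixIdeal (ψ ∘ f) k := by
  rw [prefixIdeal, Ideal.map_span, ← Set.image_comp, prefixIdeal]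

theorem prefixIdeal_congr {g : ℕ → A} (h : ∀ i < k, f i = g i) :
    prefixIdeal f k = prefixIdeal g k :=
  congrArg Ideal.span (Set.image_congr h)

/-- Exchanging the last term of a regular sequence for `z` preserves regularity of the image in
the quotient by `z`, if `z` is a nonzerodivisor modulo every initial segment. -/
theorem IsRegularPrefix.comp_of_ker {B : Type*} [CommRing B] (hreg : IsRegularPrefix f (k + 1))
    {z : A} (hz : ∀ i ≤ k, ∀ p, z * p ∈ prefixIdeal f i → p ∈ prefixIdeal f i)
    (ψ : A →+* B) (hψ : Function.Surjective ψ) (hker : RingHom.ker ψ = Ideal.span {z}) :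
    IsRegularPrefix (ψ ∘ f) k := by
  intro i hi q hq
  obtain ⟨w, rfl⟩ := hψ q
  rw [← map_prefixIdeal, Function.comp_apply, ← map_mul,
    Ideal.mem_map_iff_of_surjective ψ hψ] at hq
  obtain ⟨j, hj, hjw⟩ := hq
  have hsub : f i * w - j ∈ Ideal.span {z} := by
    rw [← hker, RingHom.mem_ker, map_sub, hjw, sub_self]
  obtain ⟨v, hv⟩ := Ideal.mem_span_singleton'.mp hsub
  have hvi : v ∈ prefixIdeal f (i + 1) := by
    refine hz _ (by omega) _ (mem_prefixIdeal_succ.mpr ⟨w, ?_⟩)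
    convert neg_mem hj using 1
    linear_combination hv
  obtain ⟨v', hv'⟩ := mem_prefixIdeal_succ.mp hvi
  have hmem : w - z * v' ∈ prefixIdeal f i := by
    refine hreg i (by omega) _ ?_
    convert add_mem hj (Ideal.mul_mem_left _ z hv') using 1
    linear_combination -hv
  have hzψ : ψ z = 0 := by
    rw [← RingHom.mem_ker, hker]; exact Ideal.mem_span_singleton_self z
  rw [← map_prefixIdeal]
  simpa [hzψ] using Ideal.mem_map_of_mem ψ hmem

/-- Exchange of socle elements: if `u` represents a socle element modulo `f 0, …, f k`, and `z`
is a nonzerodivisor modulo `f 0, …, f (k - 1)`, then any `v` with `z u ≡ f k v` modulo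
`f 0, …, f (k - 1)` represents one modulo `f 0, …, f (k - 1), z`. -/
theorem IsRegularPrefix.exchange {B : Type*} [CommRing B] (hreg : IsRegularPrefix f (k + 1))
    {z : A} (hz : ∀ p, z * p ∈ prefixIdeal f k → p ∈ prefixIdeal f k)
    (ψ : A →+* B) (hψ : Function.Surjective ψ) (hker : RingHom.ker ψ = Ideal.span {z})
    {u v : A} (huv : z * u - f k * v ∈ prefixIdeal f k) :
    (u ∉ prefixIdeal f (k + 1) → ψ v ∉ prefixIdeal (ψ ∘ f) k) ∧
    ∀ p, p * u ∈ prefixIdeal f (k + 1) → ψ p * ψ v ∈ prefixIdeal (ψ ∘ f) k := by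
  have hzψ : ψ z = 0 := by
    rw [← RingHom.mem_ker, hker]; exact Ideal.mem_span_singleton_self z
  constructor
  · intro hu hv
    rw [← map_prefixIdeal, Ideal.mem_map_iff_of_surjective ψ hψ] at hv
    obtain ⟨j, hj, hjv⟩ := hv
    have hsub : v - j ∈ Ideal.span {z} := by
      rw [← hker, RingHom.mem_ker, map_sub, hjv, sub_self]
    obtain ⟨w, hw⟩ := Ideal.mem_span_singleton'.mp hsub
    refine hu (mem_prefixIdeal_succ.mpr ⟨w, hz _ ?_⟩)
    convert add_mem huv (Ideal.mul_mem_left _ (f k) hj) using 1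
    linear_combination - f k * hw
  · intro p hp
    obtain ⟨w, hw⟩ := mem_prefixIdeal_succ.mp hp
    have hmem : p * v - z * w ∈ prefixIdeal f k := by
      refine hreg k (by omega) _ ?_
      convert sub_mem (Ideal.mul_mem_left _ z hw) (Ideal.mul_mem_left _ p huv) using 1
      ring
    rw [← map_prefixIdeal]
    simpa [hzψ] using Ideal.mem_map_of_mem ψ hmem

end Prefix

namespace MvPolynomial

variable {σ L : Type*} [Field L]

theorem homogeneousComponent_add_mul {f : MvPolynomial σ L} {e : ℕ} (hf : f.IsHomogeneous e)
    (t : ℕ) (p : MvPolynomial σ L) :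
    homogeneousComponent (e + t) (f * p) = f * homogeneousComponent t p := by
  conv_lhs => rw [← sum_homogeneousComponent p, Finset.mul_sum, map_sum]
  have h : ∀ i, homogeneousComponent (e + t) (f * homogeneousComponent i p) =
      if i = t then f * homogeneousComponent t p else 0 := fun i => by
    rw [homogeneousComponent_of_mem (hf.mul (homogeneousComponent_isHomogeneous i p))]
    by_cases hit : i = t
    · simp [hit]
    · rw [if_neg (by omega), if_neg hit]
  simp_rw [h, Finset.sum_ite_eq']
  split_ifs with ht
  · rfl
  · rw [homogeneousComponent_eq_zero _ _ (by simpa using ht), mul_zero]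

theorem homogeneousComponent_mul_of_lt {f : MvPolynomial σ L} {e s : ℕ} (hf : f.IsHomogeneous e)
    (hs : s < e) (p : MvPolynomial σ L) : homogeneousComponent s (f * p) = 0 := by
  conv_lhs => rw [← sum_homogeneousComponent p, Finset.mul_sum, map_sum]
  refine Finset.sum_eq_zero fun i _ => ?_
  rw [homogeneousComponent_of_mem (hf.mul (homogeneousComponent_isHomogeneous i p)),
    if_neg (by omega)]

attribute [local instance] MvPolynomial.gradedAlgebra in
theorem homogeneousComponent_mem_span {S : Set (MvPolynomial σ L)} {e : ℕ}
    (hS : ∀ p ∈ S, p.IsHomogeneous e) {p : MvPolynomial σ L} (hp : p ∈ Ideal.span S) (s : ℕ) :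
    homogeneousComponent s p ∈ Ideal.span S :=
  homogeneousComponent_mem_of_mem (Ideal.homogeneous_span _ _ fun q hq => ⟨e, hS q hq⟩) hp s

theorem exists_homogeneous_coeffs {ι : Type*} [Fintype ι] {F : ι → MvPolynomial σ L} {e t : ℕ}
    (hF : ∀ i, (F i).IsHomogeneous e) {p : MvPolynomial σ L} (hp : p.IsHomogeneous (e + t))
    (hmem : p ∈ Ideal.span (Set.range F)) :
    ∃ c : ι → MvPolynomial σ L, (∀ i, (c i).IsHomogeneous t) ∧ p = ∑ i, c i * F i := by
  obtain ⟨c, hc⟩ := (Ideal.mem_span_range_iff_exists_fun).mp hmem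
  refine ⟨fun i => homogeneousComponent t (c i),
    fun i => homogeneousComponent_isHomogeneous t (c i), ?_⟩
  rw [← homogeneousComponent_eq_self hp, ← hc, map_sum]
  refine Finset.sum_congr rfl fun i _ => ?_
  rw [mul_comm (c i), homogeneousComponent_add_mul (hF i), mul_comm]

theorem IsHomogeneous.mem_pow_idealOfVars {p : MvPolynomial σ L} {s t : ℕ}
    (hp : p.IsHomogeneous s) (hts : t ≤ s) : p ∈ idealOfVars σ L ^ t := by
  rw [mem_pow_idealOfVars_iff']
  exact fun x hx => hp.coeff_eq_zero (by omega)

theorem IsHomogeneous.mem_idealOfVars {p : MvPolynomial σ L} {s : ℕ}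
    (hp : p.IsHomogeneous s) (hs : 1 ≤ s) : p ∈ idealOfVars σ L := by
  simpa using hp.mem_pow_idealOfVars hs

theorem mul_mem_of_mem_idealOfVars {I : Ideal (MvPolynomial σ L)} {u : MvPolynomial σ L}
    (hu : ∀ i, X i * u ∈ I) {p : MvPolynomial σ L} (hp : p ∈ idealOfVars σ L) : p * u ∈ I := by
  have : idealOfVars σ L ≤ Submodule.colon I {u} :=
    Ideal.span_le.mpr (by
      rintro _ ⟨i, rfl⟩
      exact Submodule.mem_colon_singleton.mpr (hu i))
  exact Submodule.mem_colon_singleton.mp (this hp)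

/-- The quotient of a polynomial ring by a nonzero linear form is a polynomial ring in one
variable less. -/
theorem exists_algHom_ker_eq_span_linear {n : ℕ} {z : MvPolynomial (Fin (n + 1)) L}
    (hz : z.IsHomogeneous 1) (hz0 : z ≠ 0) :
    ∃ ψ : MvPolynomial (Fin (n + 1)) L →ₐ[L] MvPolynomial (Fin n) L,
      Function.Surjective ψ ∧ RingHom.ker ψ.toRingHom = Ideal.span {z} ∧
      (∀ p s, p.IsHomogeneous s → (ψ p).IsHomogeneous s) ∧ ∀ i, ∃ j, ψ (X j) = X i := by
  have hspan : z ∈ Submodule.span L (Set.range (X : Fin (n + 1) → MvPolynomial _ L)) := by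
    rw [← homogeneousSubmodule_one_eq_span_X]; exact hz
  obtain ⟨c, rfl⟩ := (Submodule.mem_span_range_iff_exists_fun L).mp hspan
  obtain ⟨j, hj⟩ : ∃ j, c j ≠ 0 := by
    by_contra! h
    exact hz0 (by simp [h])
  let y : MvPolynomial (Fin n) L := ∑ i, (-(c j)⁻¹ * c (j.succAbove i)) • X i
  let ψ : MvPolynomial (Fin (n + 1)) L →ₐ[L] MvPolynomial (Fin n) L := aeval (j.insertNth y X)
  let ι : MvPolynomial (Fin n) L →ₐ[L] MvPolynomial (Fin (n + 1)) L := rename j.succAbove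
  have hι : ∀ q, ψ (ι q) = q := fun q => by
    have : ψ.comp ι = AlgHom.id L _ := by ext i; simp [ψ, ι]
    exact DFunLike.congr_fun this q
  have hψz : ψ (∑ i, c i • X i) = 0 := by
    rw [Fin.sum_univ_succAbove _ j]
    simp [ψ, y, Finset.smul_sum, smul_smul, hj]
  refine ⟨ψ, fun q => ⟨ι q, hι q⟩, le_antisymm (fun p hp => ?_) ?_, fun p s hp => ?_,
    fun i => ⟨j.succAbove i, by simp [ψ]⟩⟩
  · set z := ∑ i, c i • (X i : MvPolynomial (Fin (n + 1)) L) with hzdef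
    let π := Ideal.Quotient.mkₐ L (Ideal.span {z})
    have hπ : (π.comp (ι.comp ψ)) = π := by
      ext i
      refine Fin.succAboveCases j ?_ (fun i => ?_) i
      · refine (Ideal.Quotient.eq).mpr (Ideal.mem_span_singleton'.mpr ⟨C (-(c j)⁻¹), ?_⟩)
        rw [hzdef, Fin.sum_univ_succAbove _ j]
        have hC : (C (c j)⁻¹ * C (c j) : MvPolynomial (Fin (n + 1)) L) = 1 := by
          rw [← C_mul, inv_mul_cancel₀ hj, C_1]
        change _ = ι (ψ (X j)) - X j
        simp only [ψ, ι, y, aeval_X, Fin.insertNth_apply_same, map_sum,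
          smul_eq_C_mul, map_mul, map_neg, rename_C, rename_X, Finset.mul_sum, mul_add, neg_mul,
          Finset.sum_neg_distrib, mul_assoc]
        linear_combination (- X j) * hC
      · simp [ψ, ι]
    have h0 : π p = 0 := by
      rw [← hπ]
      have : ψ p = 0 := hp
      simp [this]
    exact Ideal.Quotient.eq_zero_iff_mem.mp h0
  · rw [Ideal.span_singleton_le_iff_mem]
    exact hψz
  · have := hp.aeval (j.insertNth y X : Fin (n + 1) → MvPolynomial (Fin n) L) (n := 1) (fun i => by
      refine Fin.succAboveCases j ?_ (fun i => ?_) i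
      · rw [Fin.insertNth_apply_same]
        exact IsHomogeneous.sum _ _ _ fun i _ => 
          (homogeneousSubmodule _ L 1).smul_mem _ (isHomogeneous_X L i)
      · rw [Fin.insertNth_apply_succAbove]
        exact isHomogeneous_X L i)
    rwa [one_mul] at this

end MvPolynomial

section Macaulay

variable {L : Type*} [Field L]

/-- If `u` represents a nonzero socle element modulo a regular sequence of `k` forms of
degree `e ≥ 1` in `n` variables, then `k = n`, and if `u` is homogeneous then its degree is
`n (e - 1)`. -/
theorem IsRegularPrefix.eq_and_degree_of_socle [Infinite L] {e : ℕ} (he : 1 ≤ e) (k : ℕ) :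
    ∀ (n : ℕ) (f : ℕ → MvPolynomial (Fin n) L), (∀ i < k, (f i).IsHomogeneous e) →
      IsRegularPrefix f k → ∀ u, u ∉ prefixIdeal f k → (∀ i, X i * u ∈ prefixIdeal f k) →
      k = n ∧ ∀ s, u.IsHomogeneous s → s + k = k * e := by
  induction k with
  | zero =>
    intro n f _ _ u hu hX
    simp only [prefixIdeal_zero, Ideal.mem_bot] at hu hX
    have hn : n = 0 := by
      by_contra h
      exact (mul_ne_zero (X_ne_zero (⟨0, by omega⟩ : Fin n)) hu) (hX _)
    subst hn
    exact ⟨rfl, fun s hs => by simpa using hs.inj_right (isHomogeneous_of_isEmpty _ _ u) hu⟩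
  | succ k ih =>
    intro n f hf hreg u hu hX
    have hfm : ∀ i < k + 1, f i ∈ idealOfVars (Fin n) L :=
      fun i hi => (hf i hi).mem_idealOfVars he
    obtain _ | n := n
    · have h0 : f 0 = 0 := by
        simpa [idealOfVars, Set.range_eq_empty] using hfm 0 (by omega)
      have := hreg 0 (by omega) 1 (by simp [h0])
      simp [prefixIdeal_zero] at this
    obtain ⟨z, hz1, hz⟩ := exists_mem_forall_nonzerodivisor
      (fun i : Fin (k + 1) => prefixIdeal f i) (homogeneousSubmodule (Fin (n + 1)) L 1) (by
        intro i P _ w hw hP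
        by_contra! h
        refine hw (hreg i i.2 w (mul_mem_of_mem_idealOfVars (fun j => ?_) (hfm i i.2)))
        exact (hP _).mp (h _ (isHomogeneous_X L j)))
    replace hz : ∀ i ≤ k, ∀ p, z * p ∈ prefixIdeal f i → p ∈ prefixIdeal f i :=
      fun i hi => hz ⟨i, by omega⟩
    have hz0 : z ≠ 0 := by
      rintro rfl
      have := hz 0 (by omega) 1 (by simp)
      simp [prefixIdeal_zero] at this
    obtain ⟨ψ, hψ, hker, hhom, hvar⟩ := exists_algHom_ker_eq_span_linear hz1 hz0
    have key : ∀ v, z * u - f k * v ∈ prefixIdeal f k →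
        k = n ∧ ∀ s, (ψ v).IsHomogeneous s → s + k = k * e := by
      intro v hv
      obtain ⟨h₁, h₂⟩ := hreg.exchange (hz k le_rfl) ψ.toRingHom hψ hker hv
      refine ih n (ψ ∘ f) (fun i hi => hhom _ _ (hf i (by omega)))
        (hreg.comp_of_ker hz ψ.toRingHom hψ hker) (ψ v) (h₁ hu) fun i => ?_
      obtain ⟨j, hj⟩ := hvar i
      rw [← hj]
      exact h₂ (X j) (hX j)
    have hzu : z * u ∈ prefixIdeal f (k + 1) :=
      mul_mem_of_mem_idealOfVars hX (IsHomogeneous.mem_idealOfVars hz1 le_rfl)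
    obtain ⟨v, hv⟩ := mem_prefixIdeal_succ.mp hzu
    refine ⟨congrArg (· + 1) (key v hv).1, fun s hs => ?_⟩
    have hcomp := homogeneousComponent_mem_span (e := e) (S := f '' Set.Iio k) (by
      rintro _ ⟨i, hi, rfl⟩
      exact hf i (Nat.lt_succ_of_lt hi)) hv (1 + s)
    rw [map_sub, homogeneousComponent_eq_self (IsHomogeneous.mul hz1 hs)] at hcomp
    rcases lt_or_ge (1 + s) e with hlt | hle
    · rw [homogeneousComponent_mul_of_lt (hf k (by omega)) hlt, sub_zero] at hcomp
      exact absurd (prefixIdeal_mono (Nat.le_succ k) (hz k le_rfl _ hcomp)) hu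
    · obtain ⟨t, ht⟩ := Nat.exists_eq_add_of_le hle
      rw [ht, homogeneousComponent_add_mul (hf k (by omega))] at hcomp
      have := (key _ hcomp).2 t (hhom _ _ (homogeneousComponent_isHomogeneous t v))
      rw [add_mul, one_mul, ← this]
      omega


/-- A regular sequence of `k ≤ n` elements can be chosen among the linear combinations of forms
of degree `e` generating an ideal whose radical contains all variables. -/
theorem exists_isRegularPrefix_mem [Infinite L] {n e : ℕ} (he : 1 ≤ e)
    (V : Submodule L (MvPolynomial (Fin n) L)) (hV : V ≤ homogeneousSubmodule (Fin n) L e)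
    (hrad : ∀ i, X i ∈ (Ideal.span (V : Set (MvPolynomial (Fin n) L))).radical)
    (k : ℕ) (hk : k ≤ n) :
    ∃ g : ℕ → MvPolynomial (Fin n) L, (∀ i < k, g i ∈ V) ∧ IsRegularPrefix g k := by
  induction k with
  | zero => exact ⟨0, by simp, fun i hi => absurd hi (Nat.not_lt_zero i)⟩
  | succ k ih =>
    obtain ⟨g, hgV, hreg⟩ := ih (by omega)
    obtain ⟨v, hv, hvreg⟩ := exists_mem_forall_nonzerodivisor
      (fun _ : Unit => prefixIdeal g k) V (by
        intro _ P hprime w hw hP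
        by_contra! h
        have hle : (Ideal.span (V : Set (MvPolynomial (Fin n) L))).radical ≤ P :=
          hprime.isRadical.radical_le_iff.mpr (Ideal.span_le.mpr h)
        have := (hreg.eq_and_degree_of_socle he k n g (fun i hi => hV (hgV i hi)) w hw
          fun i => (hP _).mp (hle (hrad i))).1
        omega)
    refine ⟨Function.update g k v, fun i hi => ?_, fun i hi p hp => ?_⟩
    · rcases eq_or_ne i k with rfl | hik
      · simpa using hv
      · rw [Function.update_of_ne hik]
        exact hgV i (by omega)
    · have hcongr : prefixIdeal (Function.update g k v) i = prefixIdeal g i :=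
        prefixIdeal_congr fun j hj => Function.update_of_ne (by omega) _ _
      rw [hcongr] at hp ⊢
      rcases eq_or_ne i k with rfl | hik
      · exact hvreg () p (by simpa using hp)
      · rw [Function.update_of_ne hik] at hp
        exact hreg i (by omega) p hp

theorem IsRegularPrefix.linearIndependent {A : Type*} [CommRing A] [Algebra L A] {g : ℕ → A}
    {k : ℕ} (hreg : IsRegularPrefix g k) (htop : prefixIdeal g k ≠ ⊤) :
    LinearIndependent L fun i : Fin k => g i := by
  induction k with
  | zero => exact linearIndependent_empty_type
  | succ k ih =>
    have htop' : prefixIdeal g k ≠ ⊤ := fun h =>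
      htop (top_le_iff.mp (h ▸ prefixIdeal_mono (Nat.le_succ k)))
    refine linearIndependent_finSucc'.mpr
      ⟨ih (fun i hi => hreg i (by omega)) htop', fun hmem => htop' ?_⟩
    have hle : Submodule.span L (Set.range (Fin.init fun i : Fin (k + 1) => g i)) ≤
        (prefixIdeal g k).restrictScalars L := by
      rw [Submodule.span_le]
      rintro _ ⟨i, rfl⟩
      exact Ideal.subset_span ⟨i, i.2, rfl⟩
    rw [Ideal.eq_top_iff_one]
    exact hreg k (by omega) 1 (by simpa using hle hmem)

/-- Variables are nilpotent modulo an ideal generated by forms of degree `e` with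
finite-dimensional quotient. -/
theorem X_mem_radical_of_finite {σ : Type*} {S : Set (MvPolynomial σ L)} {e : ℕ}
    (hS : ∀ p ∈ S, p.IsHomogeneous e)
    (hfin : Module.Finite L (MvPolynomial σ L ⧸ Ideal.span S)) (i : σ) :
    X i ∈ (Ideal.span S).radical := by
  obtain ⟨q, hq, hq0⟩ := Algebra.IsAlgebraic.isAlgebraic (R := L)
    (Ideal.Quotient.mkₐ L (Ideal.span S) (X i))
  rw [Polynomial.aeval_algHom_apply] at hq0
  have hmem := homogeneousComponent_mem_span hS (Ideal.Quotient.eq_zero_iff_mem.mp hq0)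
    q.natDegree
  refine ⟨q.natDegree, ?_⟩
  have hcomp : homogeneousComponent q.natDegree (Polynomial.aeval (X i : MvPolynomial σ L) q) =
      C q.leadingCoeff * X i ^ q.natDegree := by
    rw [Polynomial.aeval_eq_sum_range, map_sum, Finset.sum_eq_single q.natDegree]
    · rw [smul_eq_C_mul, homogeneousComponent_C_mul,
        homogeneousComponent_eq_self (isHomogeneous_X_pow i _)]
      rfl
    · intro j _ hj
      rw [smul_eq_C_mul, homogeneousComponent_C_mul,
        homogeneousComponent_of_mem (isHomogeneous_X_pow i j), if_neg hj.symm, mul_zero]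
    · simp
  rw [hcomp] at hmem
  have := Ideal.mul_mem_left _ (C q.leadingCoeff⁻¹) hmem
  rwa [← mul_assoc, ← C_mul, inv_mul_cancel₀ (Polynomial.leadingCoeff_ne_zero.mpr hq), C_1,
    one_mul] at this

/-- Macaulay's bound: `n` forms of degree `e` in `n` variables with finite-dimensional quotient
generate an ideal containing all forms of degree larger than `n (e - 1)`. -/
theorem mem_span_of_degree_gt [Infinite L] {n e : ℕ} (he : 1 ≤ e)
    {F : Fin n → MvPolynomial (Fin n) L} (hF : ∀ i, (F i).IsHomogeneous e)
    (hfin : Module.Finite L (MvPolynomial (Fin n) L ⧸ Ideal.span (Set.range F)))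
    {t : ℕ} (ht : n * e < t + n) {a : MvPolynomial (Fin n) L} (ha : a.IsHomogeneous t) :
    a ∈ Ideal.span (Set.range F) := by
  have hrad := X_mem_radical_of_finite (by rintro _ ⟨i, rfl⟩; exact hF i) hfin
  let V := Submodule.span L (Set.range F)
  have hV : V ≤ homogeneousSubmodule (Fin n) L e :=
    Submodule.span_le.mpr (by rintro _ ⟨i, rfl⟩; exact hF i)
  have hspanV : Ideal.span (V : Set (MvPolynomial (Fin n) L)) = Ideal.span (Set.range F) :=
    Submodule.span_span_of_tower L _ _
  obtain ⟨g, hgV, hreg⟩ := exists_isRegularPrefix_mem he V hV (by rwa [hspanV]) n le_rfl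
  have hgF : prefixIdeal g n ≤ Ideal.span (Set.range F) := by
    rw [← hspanV]
    refine Ideal.span_mono ?_
    rintro _ ⟨i, hi, rfl⟩
    exact hgV i hi
  by_cases htop : prefixIdeal g n = ⊤
  · exact hgF (htop ▸ Submodule.mem_top)
  have hVg : V = Submodule.span L (Set.range fun i : Fin n => g i) := by
    have : FiniteDimensional L V := FiniteDimensional.span_of_finite L (Set.finite_range F)
    refine (Submodule.eq_of_le_of_finrank_le (Submodule.span_le.mpr ?_) ?_).symm
    · rintro _ ⟨i, rfl⟩
      exact hgV i i.2
    · rw [finrank_span_eq_card (hreg.linearIndependent htop)]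
      exact finrank_range_le_card F
  have hFg : Ideal.span (Set.range F) ≤ prefixIdeal g n := by
    rw [← hspanV, hVg]
    refine Ideal.span_le.mpr fun p hp => ?_
    have hle : Submodule.span L (Set.range fun i : Fin n => g i) ≤
        (prefixIdeal g n).restrictScalars L := by
      rw [Submodule.span_le]
      rintro _ ⟨i, rfl⟩
      exact Ideal.subset_span ⟨i, i.2, rfl⟩
    exact hle hp
  by_contra haF
  obtain ⟨T, hT⟩ := Ideal.exists_radical_pow_le_of_fg (Ideal.span (Set.range F))
    (IsNoetherian.noetherian _)
  have hvars : idealOfVars (Fin n) L ^ T ≤ Ideal.span (Set.range F) :=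
    (Ideal.pow_right_mono (Ideal.span_le.mpr (by rintro _ ⟨i, rfl⟩; exact hrad i)) T).trans hT
  let Q : ℕ → Prop := fun s => ∃ u : MvPolynomial (Fin n) L,
    u.IsHomogeneous s ∧ u ∉ Ideal.span (Set.range F)
  have hQ : ∀ s, Q s → s ≤ T := fun s ⟨u, hu, huF⟩ =>
    le_of_not_ge fun h => huF (hvars (hu.mem_pow_idealOfVars h))
  classical
  have hts : t ≤ Nat.findGreatest Q T := Nat.le_findGreatest (hQ t ⟨a, ha, haF⟩) ⟨a, ha, haF⟩
  obtain ⟨u, hu, huF⟩ : Q (Nat.findGreatest Q T) :=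
    Nat.findGreatest_spec (hQ t ⟨a, ha, haF⟩) ⟨a, ha, haF⟩
  have hX : ∀ i, X i * u ∈ prefixIdeal g n := fun i => hFg (by
    by_contra h
    have hQ' : Q (1 + Nat.findGreatest Q T) := ⟨_, (isHomogeneous_X L i).mul hu, h⟩
    have := Nat.le_findGreatest (hQ _ hQ') hQ'
    omega)
  have := (hreg.eq_and_degree_of_socle he n n g (fun i hi => hV (hgV i hi)) u
    (fun h => huF (hgF h)) hX).2 _ hu
  omega

end Macaulay

/-- Reduction of a fraction with numerator in the Jacobian ideal: for `ℓ ≥ 1`, modulo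
derivatives `a / f ^ (ℓ + 1)` equals `a' / f ^ ℓ`. -/
theorem exists_reduction_step {L σ : Type*} [Field L] [CharZero L] [Fintype σ]
    {d ℓ t : ℕ} (hd : 1 ≤ d) (hℓ : 1 ≤ ℓ) {f : MvPolynomial σ L} (hf : f.IsHomogeneous d)
    {a : MvPolynomial σ L} (ha : a.IsHomogeneous (t + d))
    (hmem : a ∈ Ideal.span (Set.range fun i => pderiv i f)) :
    ∃ (a' : MvPolynomial σ L) (b : σ → MvPolynomial σ L), a'.IsHomogeneous t ∧
      a = a' * f + ∑ i, (f * pderiv i (b i) - (ℓ : MvPolynomial σ L) * b i * pderiv i f) := by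
  obtain ⟨c, hc, hac⟩ := exists_homogeneous_coeffs (t := t + 1) (fun i => hf.pderiv (i := i))
    (by convert ha using 1; omega) hmem
  have hℓ0 : (ℓ : L) ≠ 0 := by exact_mod_cast (by omega : ℓ ≠ 0)
  refine ⟨∑ i, (ℓ : L)⁻¹ • pderiv i (c i), fun i => -((ℓ : L)⁻¹ • c i), ?_, ?_⟩
  · exact IsHomogeneous.sum _ _ _ fun i _ =>
      (homogeneousSubmodule _ L t).smul_mem _ (hc i).pderiv
  · rw [Finset.sum_mul, ← Finset.sum_add_distrib, hac]
    refine Finset.sum_congr rfl fun i _ => ?_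
    have hC : ((ℓ : MvPolynomial σ L) * C (ℓ : L)⁻¹) = 1 := by
      rw [← map_natCast C, ← C_mul, mul_inv_cancel₀ hℓ0, C_1]
    simp only [map_neg, smul_eq_C_mul, pderiv_C_mul]
    linear_combination (- c i * pderiv i f) * hC

/-- Iterated pole order reduction, with the derivative part written over the common
denominator `f ^ ℓ`. -/
theorem exists_reduction_of_le {L : Type*} [Field L] [CharZero L]
    {n d : ℕ} (hn : 1 ≤ n) (hd : 2 ≤ d)
    {f : MvPolynomial (Fin (n + 1)) L} (hf : f.IsHomogeneous d)
    (hH : Module.Finite L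
      (MvPolynomial (Fin (n + 1)) L ⧸
        Ideal.span (Set.range fun i : Fin (n + 1) => pderiv i f)))
    {ℓ : ℕ} (hℓ : n ≤ ℓ) :
    ∀ a : MvPolynomial (Fin (n + 1)) L, a.IsHomogeneous (ℓ * d - (n + 1)) →
    ∃ r : ℕ → MvPolynomial (Fin (n + 1)) L,
      (∀ k ∈ Finset.Icc 1 n,
        (r k).IsHomogeneous (k * d - (n + 1)) ∧ (k * d < n + 1 → r k = 0)) ∧
      ∃ b : Fin (n + 1) → MvPolynomial (Fin (n + 1)) L,
        a = ∑ k ∈ Finset.Icc 1 n, r k * f ^ (ℓ - k) + ∑ i : Fin (n + 1),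
          (f * pderiv i (b i)
            - ((ℓ - 1 : ℕ) : MvPolynomial (Fin (n + 1)) L) * b i * pderiv i f) := by
  have hnd : n + 1 ≤ n * d := by nlinarith
  induction ℓ, hℓ using Nat.le_induction with
  | base =>
    intro a ha
    refine ⟨fun k => if k = n then a else 0, fun k _ => ?_, 0, ?_⟩
    · by_cases hkn : k = n
      · subst hkn
        simpa using ⟨ha, fun h => absurd h (by omega)⟩
      · simp [hkn, isHomogeneous_zero]
    · simp [ite_mul, hn]
  | succ ℓ hℓ ih =>
    intro a ha
    have hℓd : n + 1 ≤ ℓ * d := hnd.trans (Nat.mul_le_mul_right d hℓ)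
    have hmem := mem_span_of_degree_gt (e := d - 1) (by omega)
      (fun i => hf.pderiv (i := i)) hH (t := (ℓ + 1) * d - (n + 1)) (by
        have h₁ : (n + 1) * d ≤ (ℓ + 1) * d := Nat.mul_le_mul_right d (by omega)
        have h₂ : (n + 1) * (d - 1) < (n + 1) * d :=
          Nat.mul_lt_mul_of_pos_left (by omega) (by omega)
        have h₃ : (ℓ + 1) * d = ℓ * d + d := by ring
        omega) ha
    obtain ⟨a', b, ha', hab⟩ := exists_reduction_step (t := ℓ * d - (n + 1)) (ℓ := ℓ) (by omega)
      (by omega) hf (by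
        convert ha using 1
        have h₃ : (ℓ + 1) * d = ℓ * d + d := by ring
        omega) hmem
    obtain ⟨r, hr, b', hb'⟩ := ih a' ha'
    refine ⟨r, hr, fun i => b i + f * b' i, ?_⟩
    obtain ⟨m, rfl⟩ : ∃ m, ℓ = m + 1 := ⟨ℓ - 1, by omega⟩
    rw [hab]
    nth_rewrite 1 [hb']
    rw [add_mul, Finset.sum_mul, Finset.sum_mul, add_assoc, ← Finset.sum_add_distrib]
    congr 1
    · refine Finset.sum_congr rfl fun k hk => ?_
      have := (Finset.mem_Icc.mp hk).2
      rw [mul_assoc, ← pow_succ, Nat.sub_add_comm (n := m + 1) (by omega)]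
    · refine Finset.sum_congr rfl fun i _ => ?_
      simp only [Nat.add_sub_cancel, map_add, Derivation.leibniz, smul_eq_mul, Nat.cast_add,
        Nat.cast_one]
      ring



/-- Every fraction `a/f^ℓ` of homogeneous degree `−(n+1)` is equivalent modulo
derivatives (i.e. modulo `D_f`) to a fraction `Σ_{k=1}^n r_k/f^k` with pole order
at most `n`, where `r_k` is homogeneous of degree `k·d − (n+1)` (zero when this
degree is negative). -/
theorem reduce_pole_order {L : Type*} [Field L] [CharZero L]
    (n : ℕ) (hn : 1 ≤ n) (d : ℕ) (hd : 2 ≤ d)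
    (f : MvPolynomial (Fin (n + 1)) L) (hf : f.IsHomogeneous d)
    (hH : Module.Finite L
      (MvPolynomial (Fin (n + 1)) L ⧸
        Ideal.span (Set.range fun i : Fin (n + 1) => pderiv i f)))
    (ℓ : ℕ) (hℓ : 1 ≤ ℓ) (a : MvPolynomial (Fin (n + 1)) L)
    (hadeg : n + 1 ≤ ℓ * d) (ha : a.IsHomogeneous (ℓ * d - (n + 1))) :
    ∃ r : ℕ → MvPolynomial (Fin (n + 1)) L,
      (∀ k ∈ Finset.Icc 1 n,
        (r k).IsHomogeneous (k * d - (n + 1)) ∧ (k * d < n + 1 → r k = 0)) ∧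
      ∃ (m : ℕ) (b : Fin (n + 1) → MvPolynomial (Fin (n + 1)) L),
        (a * f ^ (max ℓ n - ℓ) - ∑ k ∈ Finset.Icc 1 n, r k * f ^ (max ℓ n - k))
            * f ^ (m + 1)
          = f ^ (max ℓ n) * ∑ i : Fin (n + 1),
              (f * pderiv i (b i)
                - (m : MvPolynomial (Fin (n + 1)) L) * b i * pderiv i f) := by
  rcases le_total n ℓ with hnℓ | hℓn
  · obtain ⟨r, hr, b, hb⟩ := exists_reduction_of_le hn hd hf hH hnℓ a ha
    refine ⟨r, hr, ℓ - 1, b, ?_⟩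
    rw [max_eq_left hnℓ, Nat.sub_add_cancel hℓ, Nat.sub_self, pow_zero, mul_one]
    nth_rewrite 1 [hb]
    ring
  · refine ⟨fun k => if k = ℓ then a else 0, fun k _ => ?_, 0, 0, ?_⟩
    · by_cases hkℓ : k = ℓ
      · subst hkℓ
        simpa using ⟨ha, fun h => absurd h (by omega)⟩
      · simp [hkℓ, isHomogeneous_zero]
    · simp [ite_mul, hℓ, hℓn]
end

section
/- Let k be a field of characteristic zero, let n ≥ 1, let f ∈ k[t][x_0,…,x_n] be homogeneous in x_0,…,x_n of degree d ≥ 2, let ℓ ≥ 1, and let a ∈ k[t][x_0,…,x_n] be homogeneous in x_0,…,x_n of degree ℓ·d − (n+1). Assume that, viewing f over the rational function field k(t), the quotient k(t)[x_0,…,x_n]/Jac f is finite-dimensional over k(t). Then a/f^ℓ admits a telescoper with regular certificate of order r at most d^n: there exist r ≤ d^n, polynomials c_0,…,c_r ∈ k[t] not all zero, m ∈ ℕ, and B_0,…,B_n ∈ k(t)[x_0,…,x_n] such that (Σ_{j=0}^r c_j·P_j·f^{r−j})·f^{m+1} = f^{ℓ+r}·Σ_{i=0}^n (f·∂_i B_i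 − m·B_i·∂_i f). -/
open MvPolynomial

/-- The derivation `∂_t` on polynomials in `x₀,…` with coefficients in `R[t]`,
acting coefficientwise by `d/dt`. -/
noncomputable def dtMv {R : Type*} [CommRing R] {σ : Type*}
    (P : MvPolynomial σ (Polynomial R)) : MvPolynomial σ (Polynomial R) :=
  ∑ m ∈ P.support, monomial m (Polynomial.derivative (P.coeff m))

/-- The sequence of numerators `P_j` with `∂_t^j(a/f^ℓ) = P_j/f^{ℓ+j}`:
`P_0 = a` and `P_{j+1} = f·∂_t P_j − (ℓ+j)·P_j·∂_t f`, for an abstract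
derivation-like map `D`. -/
noncomputable def telSeq {A : Type*} [CommRing A] (D : A → A) (f a : A) (ℓ : ℕ) :
    ℕ → A
  | 0 => a
  | j + 1 => f * D (telSeq D f a ℓ j)
      - ((ℓ + j : ℕ) : A) * telSeq D f a ℓ j * D f

/-- `P / f ^ q` is a divergence `∑ i, ∂_i (B i / f ^ m)` with poles only along `f`. -/
def IsDivergence {K σ : Type*} [Field K] [Fintype σ] (f : MvPolynomial σ K) (q : ℕ)
    (P : MvPolynomial σ K) : Prop :=
  ∃ (m : ℕ) (B : σ → MvPolynomial σ K), P * f ^ (m + 1) =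
    f ^ q * ∑ i, (f * pderiv i (B i) - (m : MvPolynomial σ K) * B i * pderiv i f)

/-- The numerator of `∂_i (P / f ^ q)` over `f ^ (q + 1)`. -/
noncomputable def quotDeriv {K σ : Type*} [Field K] (f : MvPolynomial σ K) (q : ℕ) (i : σ)
    (P : MvPolynomial σ K) : MvPolynomial σ K :=
  f * pderiv i P - (q : MvPolynomial σ K) * P * pderiv i f

/-- The numerator over `f ^ (q + l.length)` of the derivative of `P / f ^ q` along the word `l`,
whose last letter acts first. -/
noncomputable def quotDerivWord {K σ : Type*} [Field K] (f : MvPolynomial σ K) (q : ℕ)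
    (P : MvPolynomial σ K) : List σ → MvPolynomial σ K
  | [] => P
  | i :: l => quotDeriv f (q + l.length) i (quotDerivWord f q P l)

/-- The iterated partial derivative along a word, whose first letter acts first. -/
noncomputable def pderivWord {K σ : Type*} [Field K] :
    List σ → MvPolynomial σ K → MvPolynomial σ K
  | [], g => g
  | i :: l, g => pderivWord l (pderiv i g)

namespace IsDivergence

variable {K σ : Type*} [Field K] [Fintype σ] {f P Q : MvPolynomial σ K} {q : ℕ}

theorem raise_pole {m : ℕ} {B : σ → MvPolynomial σ K}
    (h : P * f ^ (m + 1) =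
      f ^ q * ∑ i, (f * pderiv i (B i) - (m : MvPolynomial σ K) * B i * pderiv i f)) (j : ℕ) :
    ∃ B' : σ → MvPolynomial σ K, P * f ^ (m + j + 1) =
      f ^ q * ∑ i, (f * pderiv i (B' i) -
        ((m + j : ℕ) : MvPolynomial σ K) * B' i * pderiv i f) := by
  induction j with
  | zero => exact ⟨B, h⟩
  | succ j ih =>
    obtain ⟨B', hB'⟩ := ih
    refine ⟨fun i => B' i * f, ?_⟩
    have key : ∀ i, f * pderiv i (B' i * f) -
        ((m + (j + 1) : ℕ) : MvPolynomial σ K) * (B' i * f) * pderiv i f =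
        f * (f * pderiv i (B' i) - ((m + j : ℕ) : MvPolynomial σ K) * B' i * pderiv i f) := by
      intro i
      rw [pderiv_mul]
      push_cast
      ring
    simp only [key]
    rw [← Finset.mul_sum, mul_left_comm, ← hB']
    ring

theorem zero : IsDivergence f q 0 := ⟨0, 0, by simp⟩

theorem add (hP : IsDivergence f q P) (hQ : IsDivergence f q Q) : IsDivergence f q (P + Q) := by
  obtain ⟨m, B, hB⟩ := hP
  obtain ⟨m', B', hB'⟩ := hQ
  obtain ⟨E, hE⟩ := raise_pole hB m'
  obtain ⟨E', hE'⟩ := raise_pole hB' m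
  rw [Nat.add_comm m' m] at hE'
  refine ⟨m + m', fun i => E i + E' i, ?_⟩
  rw [add_mul, hE, hE', ← mul_add, ← Finset.sum_add_distrib]
  congr 1
  refine Finset.sum_congr rfl fun i _ => ?_
  rw [map_add]
  ring

theorem C_mul (c : K) (hP : IsDivergence f q P) : IsDivergence f q (C c * P) := by
  obtain ⟨m, B, hB⟩ := hP
  refine ⟨m, fun i => C c * B i, ?_⟩
  rw [mul_assoc, hB, mul_left_comm, Finset.mul_sum]
  congr 1
  refine Finset.sum_congr rfl fun i _ => ?_
  rw [pderiv_C_mul]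
  ring

theorem sum {ι : Type*} (s : Finset ι) (u : ι → MvPolynomial σ K)
    (h : ∀ j ∈ s, IsDivergence f q (u j)) : IsDivergence f q (∑ j ∈ s, u j) := by
  classical
  induction s using Finset.induction_on with
  | empty => simpa using zero
  | insert j s hj ih =>
    rw [Finset.sum_insert hj]
    exact (h j (by simp)).add (ih fun i hi => h i (by simp [hi]))

theorem f_mul (hP : IsDivergence f q P) : IsDivergence f (q + 1) (f * P) := by
  obtain ⟨m, B, hB⟩ := hP
  refine ⟨m, B, ?_⟩
  rw [mul_assoc, hB]
  ring

theorem of_f_pow_mul (hf : f ≠ 0) {s : ℕ} (h : IsDivergence f (q + s) (f ^ s * P)) :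
    IsDivergence f q P := by
  obtain ⟨m, B, hB⟩ := h
  refine ⟨m, B, mul_left_cancel₀ (pow_ne_zero s hf) ?_⟩
  rw [← mul_assoc, hB, pow_add]
  ring

theorem quotDeriv (i : σ) (P : MvPolynomial σ K) :
    IsDivergence f (q + 1) (quotDeriv f q i P) := by
  classical
  refine ⟨q, Pi.single i P, ?_⟩
  rw [Finset.sum_eq_single i]
  · simp only [Pi.single_eq_same, _root_.quotDeriv]
    ring
  · intro j _ hj
    simp [Pi.single_eq_of_ne hj]
  · simp

/-- Integration by parts along a word. -/
theorem mul_quotDerivWord_sub (l : List σ) (g : MvPolynomial σ K) :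
    IsDivergence f (q + l.length) (g * quotDerivWord f q P l -
      C ((-1) ^ l.length) * (f ^ l.length * (pderivWord l g * P))) := by
  induction l generalizing g with
  | nil => simpa [quotDerivWord, pderivWord] using zero
  | cons i l ih =>
    have h₁ := quotDeriv (f := f) (q := q + l.length) i (g * quotDerivWord f q P l)
    have h₂ := ((ih (pderiv i g)).f_mul).C_mul (-1)
    convert h₁.add h₂ using 1
    · rfl
    · simp only [quotDerivWord, pderivWord, _root_.quotDeriv, List.length_cons, pderiv_mul,
        pow_succ, map_mul, map_neg, map_one]
      ring

end IsDivergence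

section Homogeneous

variable {K σ : Type*} [Field K]

theorem MvPolynomial.IsHomogeneous.quotDeriv {f P : MvPolynomial σ K} {d h : ℕ}
    (hd : 1 ≤ d) (hf : f.IsHomogeneous d) (hP : P.IsHomogeneous h) (q : ℕ) (i : σ) :
    (quotDeriv f q i P).IsHomogeneous (h + (d - 1)) := by
  refine IsHomogeneous.sub ?_ ?_
  · rcases Nat.eq_zero_or_pos h with rfl | hh
    · have : pderiv i P = 0 := by
        rw [(totalDegree_eq_zero_iff_eq_C.1 (Nat.le_zero.1 hP.totalDegree_le)), pderiv_C]
      rw [this, mul_zero]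
      exact isHomogeneous_zero _ _ _
    · have := hf.mul (hP.pderiv (i := i))
      rwa [show d + (h - 1) = h + (d - 1) by omega] at this
  · have h₀ : ((q : ℕ) : MvPolynomial σ K).IsHomogeneous 0 := by
      rw [← map_natCast (C : K →+* MvPolynomial σ K)]
      exact isHomogeneous_C _ _
    simpa using (h₀.mul hP).mul (hf.pderiv (i := i))

theorem MvPolynomial.IsHomogeneous.quotDerivWord {f P : MvPolynomial σ K} {d h : ℕ}
    (hd : 1 ≤ d) (hf : f.IsHomogeneous d) (hP : P.IsHomogeneous h) (q : ℕ) (l : List σ) :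
    (quotDerivWord f q P l).IsHomogeneous (h + l.length * (d - 1)) := by
  induction l with
  | nil => simpa [_root_.quotDerivWord] using hP
  | cons i l ih =>
    have := IsHomogeneous.quotDeriv hd hf ih (q + l.length) i
    rwa [show h + l.length * (d - 1) + (d - 1) = h + (i :: l).length * (d - 1) by
      simp [Nat.succ_mul, Nat.add_assoc]] at this

/-- More homogeneous polynomials of degree `D` than monomials of degree `D` are dependent. -/
theorem exists_relation_of_isHomogeneous [Fintype σ] [DecidableEq σ] {ι : Type*} [Fintype ι]
    (D : ℕ) (v : ι → MvPolynomial σ K) (hv : ∀ i, (v i).IsHomogeneous D)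
    (hcard : (Finset.finsuppAntidiag (Finset.univ : Finset σ) D).card < Fintype.card ι) :
    ∃ p : ι → K, p ≠ 0 ∧ ∑ i, C (p i) * v i = 0 := by
  let S := Finset.finsuppAntidiag (Finset.univ : Finset σ) D
  let T : (ι → K) →ₗ[K] (S → K) :=
    LinearMap.pi fun α => ∑ i, (coeff (α : σ →₀ ℕ) (v i)) • LinearMap.proj i
  have hker : T.ker ≠ ⊥ := LinearMap.ker_ne_bot_of_finrank_lt (by simpa [S] using hcard)
  obtain ⟨p, hp, hp0⟩ := Submodule.exists_mem_ne_zero_of_ne_bot hker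
  refine ⟨p, hp0, ?_⟩
  ext α
  rw [coeff_sum, coeff_zero]
  simp only [coeff_C_mul]
  by_cases hα : α.degree = D
  · have hmem : α ∈ S := by
      simp only [S, Finset.mem_finsuppAntidiag, Finset.subset_univ, and_true]
      rw [← hα, Finsupp.degree_eq_sum]
    have := congrFun (LinearMap.mem_ker.1 hp) ⟨α, hmem⟩
    simpa [T, mul_comm] using this
  · exact Finset.sum_eq_zero fun i _ => by rw [(hv i).coeff_eq_zero hα, mul_zero]

theorem pderivWord_zero (l : List σ) : pderivWord l (0 : MvPolynomial σ K) = 0 := by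
  induction l with
  | nil => rfl
  | cons i l ih => simpa [pderivWord] using ih

theorem pderivWord_monomial_of_ne (l : List σ) (α : σ →₀ ℕ) (hα : α.degree = l.length)
    (hne : α ≠ (l.map fun i => Finsupp.single i 1).sum) (c : K) :
    pderivWord l (monomial α c) = 0 := by
  induction l generalizing α c with
  | nil => exact absurd ((Finsupp.degree_eq_zero_iff α).1 hα) (by simpa using hne)
  | cons i l ih =>
    rw [pderivWord, pderiv_monomial]
    by_cases hi : α i = 0
    · simp [hi, pderivWord_zero]
    · have hle : Finsupp.single i 1 ≤ α := by
        rw [Finsupp.single_le_iff]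
        omega
      obtain ⟨β, rfl⟩ := exists_add_of_le hle
      rw [add_tsub_cancel_left]
      refine ih β ?_ ?_ _
      · rw [map_add, Finsupp.degree_single, List.length_cons] at hα
        omega
      · rintro rfl
        exact hne (by simp)

theorem pderivWord_monomial_self [CharZero K] (l : List σ) (α : σ →₀ ℕ)
    (hα : α = (l.map fun i => Finsupp.single i 1).sum) (c : K) (hc : c ≠ 0) :
    ∃ e : K, e ≠ 0 ∧ pderivWord l (monomial α c) = C e := by
  induction l generalizing α c with
  | nil => exact ⟨c, hc, by simp [hα, pderivWord]⟩
  | cons i l ih =>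
    subst hα
    rw [pderivWord, pderiv_monomial, List.map_cons, List.sum_cons, add_tsub_cancel_left]
    refine ih _ rfl _ (mul_ne_zero hc ?_)
    rw [Nat.cast_ne_zero]
    simp

theorem exists_word (α : σ →₀ ℕ) :
    ∃ l : List σ, (l.map fun i => Finsupp.single i 1).sum = α ∧ l.length = α.degree := by
  classical
  refine ⟨(Finsupp.toMultiset α).toList, ?_, ?_⟩
  · rw [← Multiset.sum_coe, ← Multiset.map_coe, Multiset.coe_toList]
    ext i
    rw [← Finsupp.count_toMultiset α i]
    induction Finsupp.toMultiset α using Multiset.induction_on with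
    | empty => simp
    | cons j s ih => simp [ih, Multiset.count_cons, Finsupp.single_apply, Nat.add_comm, eq_comm]
  · rw [Multiset.length_toList, Finsupp.card_toMultiset]
    rfl

/-- If the derivatives of order `s` of the `u j / f ^ q` outnumber the monomials of their degree,
then the `u j / f ^ q` are dependent modulo divergences. -/
theorem exists_isDivergence_of_card_lt [CharZero K] [Fintype σ] [DecidableEq σ] {ι : Type*}
    [Fintype ι] {f : MvPolynomial σ K} (hf0 : f ≠ 0) {d h : ℕ} (hd : 1 ≤ d)
    (hf : f.IsHomogeneous d) (q s : ℕ) (u : ι → MvPolynomial σ K)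
    (hu : ∀ j, (u j).IsHomogeneous h)
    (hcard : (Finset.finsuppAntidiag (Finset.univ : Finset σ) (h + s * (d - 1))).card <
      Fintype.card ι * (Finset.finsuppAntidiag (Finset.univ : Finset σ) s).card) :
    ∃ c : ι → K, c ≠ 0 ∧ IsDivergence f q (∑ j, C (c j) * u j) := by
  choose w hw hlen using exists_word (σ := σ)
  let S := Finset.finsuppAntidiag (Finset.univ : Finset σ) s
  have hS : ∀ α ∈ S, α.degree = s := fun α hα => by
    rw [Finsupp.degree_eq_sum]
    exact (Finset.mem_finsuppAntidiag.1 hα).1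
  have hwS : ∀ α ∈ S, (w α).length = s := fun α hα => (hlen α).trans (hS α hα)
  obtain ⟨p, hp0, hp⟩ := exists_relation_of_isHomogeneous (ι := ι × S) (h + s * (d - 1))
    (fun x => quotDerivWord f q (u x.1) (w x.2))
    (fun x => by
      have := IsHomogeneous.quotDerivWord hd hf (hu x.1) q (w x.2)
      rwa [hwS _ x.2.2] at this)
    (by simpa [S] using hcard)
  obtain ⟨⟨j₀, α⟩, hj₀⟩ := Function.ne_iff.1 hp0
  obtain ⟨e, he, hword⟩ := pderivWord_monomial_self (w α) (α : σ →₀ ℕ) (hw α).symm (1 : K)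
    one_ne_zero
  have hdiv : IsDivergence f (q + s) (∑ x : ι × S, C (p x) *
      (monomial (α : σ →₀ ℕ) 1 * quotDerivWord f q (u x.1) (w x.2) -
        C ((-1) ^ s) * (f ^ s * (pderivWord (w x.2) (monomial (α : σ →₀ ℕ) 1) * u x.1)))) :=
    IsDivergence.sum _ _ fun x _ => by
      have := IsDivergence.mul_quotDerivWord_sub (f := f) (q := q) (P := u x.1) (w x.2)
        (monomial (α : σ →₀ ℕ) 1)
      rw [hwS _ x.2.2] at this
      exact this.C_mul _
  have hfirst : ∑ x : ι × S, C (p x) *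
      (monomial (α : σ →₀ ℕ) 1 * quotDerivWord f q (u x.1) (w x.2)) = 0 := by
    simp only [mul_left_comm (C _) (monomial _ _)]
    rw [← Finset.mul_sum, hp, mul_zero]
  have hsecond : ∀ j, ∑ β : S, C (p (j, β)) *
      (C ((-1) ^ s) * (f ^ s * (pderivWord (w β) (monomial (α : σ →₀ ℕ) 1) * u j))) =
      C ((-1) ^ s) * (f ^ s * (C (p (j, α) * e) * u j)) := by
    intro j
    rw [Finset.sum_eq_single α]
    · rw [hword, C_mul]
      ring
    · intro β _ hβ
      rw [pderivWord_monomial_of_ne]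
      · ring
      · rw [hS _ α.2, hwS _ β.2]
      · rw [hw]
        exact fun h => hβ (Subtype.ext h.symm)
    · simp
  simp only [mul_sub, Finset.sum_sub_distrib, hfirst, zero_sub] at hdiv
  rw [Fintype.sum_prod_type] at hdiv
  simp only [hsecond] at hdiv
  refine ⟨fun j => p (j, α) * e, Function.ne_iff.2 ⟨j₀, mul_ne_zero hj₀ he⟩, ?_⟩
  refine IsDivergence.of_f_pow_mul hf0 (s := s) ?_
  convert hdiv.C_mul (-(-1) ^ s) using 1
  rw [← Finset.mul_sum, ← Finset.mul_sum, map_neg, neg_mul_neg, ← mul_assoc, ← C_mul, ← mul_pow]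
  simp

end Homogeneous

theorem choose_lt_mul_choose (n d s : ℕ) (hs : 1 ≤ s) :
    (s * d).choose n < (d ^ n + 1) * (s + n).choose n := by
  refine lt_of_mul_lt_mul_left (a := n.factorial) ?_ (Nat.zero_le _)
  calc n.factorial * (s * d).choose n = (s * d).descFactorial n :=
        (Nat.descFactorial_eq_factorial_mul_choose _ _).symm
    _ ≤ (s * d) ^ n := Nat.descFactorial_le_pow _ _
    _ = d ^ n * s ^ n := by rw [mul_pow, mul_comm]
    _ < (d ^ n + 1) * s ^ n := Nat.mul_lt_mul_of_pos_right (Nat.lt_succ_self _) (by positivity)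
    _ ≤ (d ^ n + 1) * (s + 1) ^ n := by gcongr; omega
    _ ≤ (d ^ n + 1) * (s + 1).ascFactorial n := by
        gcongr
        exact Nat.pow_succ_le_ascFactorial _ _
    _ = n.factorial * ((d ^ n + 1) * (s + n).choose n) := by
        rw [Nat.ascFactorial_eq_factorial_mul_choose]
        ring

section TelescopingSequence

variable {R σ : Type*} [CommRing R]

theorem MvPolynomial.IsHomogeneous.dtMv {P : MvPolynomial σ (Polynomial R)} {h : ℕ}
    (hP : P.IsHomogeneous h) : (dtMv P).IsHomogeneous h :=
  IsHomogeneous.sum _ _ _ fun m hm => isHomogeneous_monomial _ (by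
    by_contra hne
    exact mem_support_iff.1 hm (hP.coeff_eq_zero hne))

theorem MvPolynomial.IsHomogeneous.telSeq {f a : MvPolynomial σ (Polynomial R)} {d h : ℕ}
    (hf : f.IsHomogeneous d) (ha : a.IsHomogeneous h) (ℓ j : ℕ) :
    (telSeq _root_.dtMv f a ℓ j).IsHomogeneous (h + j * d) := by
  induction j with
  | zero => simpa [_root_.telSeq] using ha
  | succ j ih =>
    have h₀ : ((ℓ + j : ℕ) : MvPolynomial σ (Polynomial R)).IsHomogeneous 0 := by
      rw [← map_natCast (C : Polynomial R →+* MvPolynomial σ (Polynomial R))]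
      exact isHomogeneous_C _ _
    refine IsHomogeneous.sub ?_ ?_
    · have := hf.mul ih.dtMv
      rwa [show d + (h + j * d) = h + (j + 1) * d by ring] at this
    · have := (h₀.mul ih).mul hf.dtMv
      rwa [show 0 + (h + j * d) + d = h + (j + 1) * d by ring] at this

end TelescopingSequence

/-- Existence of a telescoper with regular certificate of order at most `d^n`
for `a/f^ℓ`, under Hypothesis (H) over `k(t)`. -/
theorem telescoper_exists_regular {k : Type*} [Field k] [CharZero k]
    (n : ℕ) (hn : 1 ≤ n) (d : ℕ) (hd : 2 ≤ d) (ℓ : ℕ) (hℓ : 1 ≤ ℓ)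
    (f a : MvPolynomial (Fin (n + 1)) (Polynomial k))
    (hf : f.IsHomogeneous d)
    (hadeg : n + 1 ≤ ℓ * d) (ha : a.IsHomogeneous (ℓ * d - (n + 1)))
    (hH : Module.Finite (RatFunc k)
      (MvPolynomial (Fin (n + 1)) (RatFunc k) ⧸
        Ideal.span (Set.range fun i : Fin (n + 1) =>
          pderiv i (MvPolynomial.map (algebraMap (Polynomial k) (RatFunc k)) f)))) :
    ∃ r ≤ d ^ n, ∃ c : ℕ → Polynomial k, (∃ j ≤ r, c j ≠ 0) ∧
      ∃ (m : ℕ) (B : Fin (n + 1) → MvPolynomial (Fin (n + 1)) (RatFunc k)),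
        MvPolynomial.map (algebraMap (Polynomial k) (RatFunc k))
            ((∑ j ∈ Finset.range (r + 1),
                MvPolynomial.C (c j) * telSeq dtMv f a ℓ j * f ^ (r - j)) * f ^ (m + 1))
          = (MvPolynomial.map (algebraMap (Polynomial k) (RatFunc k)) f) ^ (ℓ + r) *
              ∑ i : Fin (n + 1),
                (MvPolynomial.map (algebraMap (Polynomial k) (RatFunc k)) f * pderiv i (B i)
                  - (m : MvPolynomial (Fin (n + 1)) (RatFunc k)) * B i *
                      pderiv i (MvPolynomial.map (algebraMap (Polynomial k) (RatFunc k)) f)) := by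
  classical
  set φ := algebraMap (Polynomial k) (RatFunc k) with hφ
  have hφinj : Function.Injective φ := IsFractionRing.injective _ _
  by_cases hf0 : f = 0
  · subst hf0
    exact ⟨0, Nat.zero_le _, fun _ => 1, ⟨0, le_rfl, one_ne_zero⟩, 0, 0, by simp⟩
  set F := MvPolynomial.map φ f with hF
  have hF0 : F ≠ 0 := fun h => hf0 (map_injective φ hφinj (by rw [← hF, h, map_zero]))
  set r := d ^ n with hr
  let u : Fin (r + 1) → MvPolynomial (Fin (n + 1)) (RatFunc k) := fun j =>
    MvPolynomial.map φ (telSeq dtMv f a ℓ j * f ^ (r - (j : ℕ)))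
  have hu : ∀ j, (u j).IsHomogeneous (ℓ * d - (n + 1) + r * d) := by
    intro j
    refine IsHomogeneous.map ?_ φ
    have := (IsHomogeneous.telSeq hf ha ℓ j).mul (hf.pow (r - (j : ℕ)))
    rwa [show ℓ * d - (n + 1) + j * d + d * (r - (j : ℕ)) = ℓ * d - (n + 1) + r * d by
      rw [mul_comm d, add_assoc, ← add_mul, Nat.add_sub_cancel' (Nat.lt_succ_iff.1 j.2)]] at this
  obtain ⟨s, hs⟩ : ∃ s, s = (ℓ + r) * d := ⟨_, rfl⟩
  have hs1 : 1 ≤ s := by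
    rw [hs]
    exact Nat.mul_pos (by omega) (by omega)
  have hcount : ∀ D : ℕ, (Finset.finsuppAntidiag (Finset.univ : Finset (Fin (n + 1))) D).card =
      (D + n).choose n := by
    intro D
    rw [Finset.card_finsuppAntidiag_nat_eq_choose, Finset.card_univ, Fintype.card_fin,
      show n + 1 + D - 1 = D + n by omega, Nat.choose_symm_add]
  obtain ⟨c, hc0, hc⟩ := exists_isDivergence_of_card_lt hF0 (by omega) (hf.map φ) (ℓ + r) s u hu
    (by
      rw [hcount, hcount, Fintype.card_fin]
      refine lt_of_le_of_lt (Nat.choose_le_choose n ?_) (choose_lt_mul_choose n d s hs1)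
      have h₁ : s * d = s + s * (d - 1) := by
        obtain ⟨d', rfl⟩ := Nat.exists_eq_add_of_le (show 1 ≤ d by omega)
        rw [Nat.add_sub_cancel_left]
        ring
      have h₂ : s = ℓ * d + r * d := by rw [hs, add_mul]
      omega)
  obtain ⟨b, hb⟩ := IsLocalization.exist_integer_multiples_of_finite
    (nonZeroDivisors (Polynomial k)) c
  choose e he using hb
  have hb0 : φ b ≠ 0 := fun h => nonZeroDivisors.coe_ne_zero b (hφinj (by rw [h, map_zero]))
  have he' : ∀ j, φ (e j) = φ b * c j := fun j => by
    rw [he j, Algebra.smul_def]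
  obtain ⟨m, B, hB⟩ := hc.C_mul (φ b)
  obtain ⟨j₀, hj₀⟩ := Function.ne_iff.1 hc0
  refine ⟨r, le_rfl, fun j => if hj : j < r + 1 then e ⟨j, hj⟩ else 0,
    ⟨j₀, Nat.lt_succ_iff.1 j₀.2, ?_⟩, m, B, ?_⟩
  · intro h
    simp only [dif_pos j₀.2] at h
    exact mul_ne_zero hb0 hj₀ (by rw [← he', h, map_zero])
  · rw [← hB, map_mul, map_pow, ← hF]
    congr 1
    rw [map_sum, Finset.sum_range, Finset.mul_sum]
    refine Finset.sum_congr rfl fun j _ => ?_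
    simp only [dif_pos j.2]
    rw [mul_assoc, map_mul, map_C, he', C_mul, mul_assoc]
end
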